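/- Let g : ℕ → ℝ be a function with g(n) > 0 for all n, such that n ↦ n/g(n) is non-decreasing and tends to infinity. Then there exists a non-decreasing unbounded function f : ℕ → ℕ such that for every ring R and every finite nonempty subset X ⊆ R, writing Z := X − X, at least one of the following holds: (i) |X + X + X·X| ≥ f(|X|)·|X|; (ii) there exist a subring R' of R and a two-sided ideal I of R' with I ⊆ R' ∩ (4Z + Z·4Z) (hence I ⊆ R' ∩ Z₃) such that R'/I is nilpotent (of class at most m for some m ∈ ℕ) and |Z₃ ∩ R'| ≥ g(|X|). -/

import Mathlib

open Pointwise

universe u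

/-- `iterX Z n` is `Zₙ` where `Z₀ = Z` and `Z_{n+1} = Z_n + Z_n + Z_n · Z_n`. -/
def iterX {R : Type u} [NonUnitalRing R] (Z : Set R) : ℕ → Set R
  | 0 => Z
  | n + 1 => iterX Z n + iterX Z n + iterX Z n * iterX Z n

/-- `mulIter S n` is the set of (left-nested) products of `n+1` elements of `S`. -/
def mulIter {R : Type u} [NonUnitalRing R] (S : Set R) : ℕ → Set R
  | 0 => S
  | n + 1 => mulIter S n * S

/-- `S` is a subring of the ambient ring (as a set). -/
def IsSubringSet {R : Type u} [NonUnitalRing R] (S : Set R) : Prop :=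
  (0 : R) ∈ S ∧ (∀ x ∈ S, ∀ y ∈ S, x + y ∈ S) ∧ (∀ x ∈ S, -x ∈ S) ∧
    ∀ x ∈ S, ∀ y ∈ S, x * y ∈ S

/-- `I` is a two-sided ideal of the subring `S` (both given as sets). -/
def IsTwoSidedIdealIn {R : Type u} [NonUnitalRing R] (I S : Set R) : Prop :=
  I ⊆ S ∧ (0 : R) ∈ I ∧ (∀ x ∈ I, ∀ y ∈ I, x + y ∈ I) ∧ (∀ x ∈ I, -x ∈ I) ∧
    ∀ r ∈ S, ∀ x ∈ I, r * x ∈ I ∧ x * r ∈ I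


/-- Standard additive character on the circle. -/
noncomputable def ee (x : AddCircle (1 : ℝ)) : ℂ := (AddCircle.toCircle x : ℂ)

lemma ee_add (x y : AddCircle (1 : ℝ)) : ee (x + y) = ee x * ee y := by
  simp [ee, AddCircle.toCircle_add]

lemma ee_zero : ee 0 = 1 := by simp [ee]

lemma ee_neg (x : AddCircle (1 : ℝ)) : ee (-x) = (starRingEnd ℂ) (ee x) := by
  simp only [ee, AddCircle.toCircle_neg, Circle.coe_inv_eq_conj]

lemma ee_norm (x : AddCircle (1 : ℝ)) : ‖ee x‖ = 1 := Circle.norm_coe _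

lemma ee_nsmul (n : ℕ) (x : AddCircle (1 : ℝ)) : ee (n • x) = ee x ^ n := by
  simp [ee, AddCircle.toCircle_nsmul]

lemma ee_eq_one {x : AddCircle (1 : ℝ)} (h : ee x = 1) : x = 0 := by
  apply AddCircle.injective_toCircle (one_ne_zero)
  rw [AddCircle.toCircle_zero]
  exact Subtype.ext (by simpa [ee] using h)

lemma circ_rep (x : AddCircle (1 : ℝ)) : ∃ t : ℝ, (t : AddCircle (1 : ℝ)) = x ∧ |t| ≤ 1 / 2 ∧ ‖x‖ = |t| := by
  obtain ⟨t, rfl⟩ := QuotientAddGroup.mk_surjective x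
  refine ⟨t - round t, ?_, abs_sub_round t, ?_⟩
  · have : ((round t : ℝ) : AddCircle (1 : ℝ)) = 0 := by
      have := AddCircle.coe_eq_zero_iff (p := (1 : ℝ)) (x := (round t : ℝ))
      rw [this]
      exact ⟨round t, by simp⟩
    rw [AddCircle.coe_sub, this, sub_zero]
  · have := UnitAddCircle.norm_eq (x := t)
    exact this

lemma ee_coe (t : ℝ) : ee (t : AddCircle (1 : ℝ)) = Complex.exp ((2 * Real.pi * t : ℝ) * Complex.I) := by
  simp [ee, AddCircle.toCircle_apply_mk, Circle.coe_exp]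

lemma ee_re (x : AddCircle (1 : ℝ)) (h : ‖x‖ ≤ 1 / 8) : 1 / 2 ≤ (ee x).re := by
  obtain ⟨t, rfl, ht, hn⟩ := circ_rep x
  rw [ee_coe, Complex.exp_ofReal_mul_I_re]
  rw [hn] at h
  rw [← Real.cos_pi_div_three, ← Real.cos_abs (2 * Real.pi * t)]
  have hp := Real.pi_pos
  apply Real.cos_le_cos_of_nonneg_of_le_pi
  · positivity
  · linarith
  · rw [abs_mul, abs_of_pos (by positivity : (0:ℝ) < 2 * Real.pi)]
    nlinarith

lemma ee_sub_one (x : AddCircle (1 : ℝ)) : 4 * ‖x‖ ≤ ‖ee x - 1‖ := by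
  obtain ⟨t, rfl, ht, hn⟩ := circ_rep x
  rw [hn, ee_coe]
  have h1 : ‖Complex.exp ((2 * Real.pi * t : ℝ) * Complex.I) - 1‖ = ‖2 * Real.sin (2 * Real.pi * t / 2)‖ := by
    rw [mul_comm]; exact Complex.norm_exp_I_mul_ofReal_sub_one _
  rw [h1, Real.norm_eq_abs, abs_mul, abs_two]
  have hp := Real.pi_pos
  have h2 : 2 / Real.pi * |2 * Real.pi * t / 2| ≤ |Real.sin (2 * Real.pi * t / 2)| := by
    apply Real.mul_abs_le_abs_sin
    rw [show 2 * Real.pi * t / 2 = Real.pi * t by ring, abs_mul, abs_of_pos hp]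
    nlinarith
  rw [show 2 * Real.pi * t / 2 = Real.pi * t by ring, abs_mul, abs_of_pos hp] at h2
  rw [show 2 * Real.pi * t / 2 = Real.pi * t by ring]
  have : 2 / Real.pi * (Real.pi * |t|) = 2 * |t| := by field_simp
  linarith

/-- Doubling property of the circle norm. -/
lemma circ_double (x : AddCircle (1 : ℝ)) (h : ‖x‖ ≤ 1 / 4) : ‖x + x‖ = 2 * ‖x‖ := by
  obtain ⟨t, rfl, ht, hn⟩ := circ_rep x
  rw [hn] at h ⊢
  rw [← AddCircle.coe_add, (AddCircle.norm_coe_eq_abs_iff (p := (1 : ℝ)) one_ne_zero).2]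
  · rw [← two_mul, abs_mul, abs_two]
  · rw [← two_mul, abs_mul, abs_two, abs_one]; linarith

lemma exists_char {A : Type u} [AddCommGroup A] (d : A) (hd : d ≠ 0) :
    ∃ (γ : A →+ AddCircle (1 : ℝ)) (n : ℕ), 0 < n ∧ n • γ d = 0 ∧ γ d ≠ 0 := by
  obtain ⟨c, hc⟩ := CharacterModule.exists_character_apply_ne_zero_of_ne_zero hd
  let φ : AddCircle (1 : ℚ) →+ AddCircle (1 : ℝ) :=
    QuotientAddGroup.map _ _ (Rat.castHom ℝ).toAddMonoidHom (by
      intro x hx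
      obtain ⟨k, hk⟩ := AddSubgroup.mem_zmultiples_iff.1 hx
      refine AddSubgroup.mem_zmultiples_iff.2 ⟨k, ?_⟩
      subst hk
      simp)
  have hφ : ∀ y, φ y = 0 → y = 0 := by
    intro y hy
    obtain ⟨q, rfl⟩ := QuotientAddGroup.mk_surjective y
    have h2 : ((q : ℝ) : AddCircle (1 : ℝ)) = 0 := hy
    rw [AddCircle.coe_eq_zero_iff] at h2
    obtain ⟨k, hk⟩ := h2
    refine (AddCircle.coe_eq_zero_iff (p := (1 : ℚ))).2 ⟨k, ?_⟩
    simp only [zsmul_eq_mul, mul_one] at hk ⊢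
    exact_mod_cast hk
  have htor : ∀ y : AddCircle (1 : ℚ), ∃ n : ℕ, 0 < n ∧ n • y = 0 := by
    intro y
    obtain ⟨q, rfl⟩ := QuotientAddGroup.mk_surjective y
    refine ⟨q.den, q.den_pos, ?_⟩
    refine (AddCircle.coe_eq_zero_iff (p := (1 : ℚ))).2 ⟨q.num, ?_⟩
    simp only [zsmul_eq_mul, mul_one, nsmul_eq_mul]
    rw [mul_comm]; exact (Rat.mul_den_eq_num q).symm
  obtain ⟨n, hn, hn0⟩ := htor (c d)
  refine ⟨φ.comp (c : A →+ AddCircle (1 : ℚ)), n, hn, ?_, ?_⟩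
  · change n • φ (c d) = 0
    rw [← map_nsmul, hn0, map_zero]
  · intro h; exact hc (hφ _ h)

lemma char_family {A : Type u} [AddCommGroup A] [DecidableEq A] (D : Finset A) :
    ∃ (ι : Type) (_ : Fintype ι) (_ : Nonempty ι) (l : ι → A →+ AddCircle (1 : ℝ)),
      ∀ d ∈ D, d ≠ 0 → ∑ i, ee (l i d) = 0 := by
  induction D using Finset.induction_on with
  | empty => exact ⟨Unit, inferInstance, inferInstance, fun _ => 0, by simp⟩
  | insert d D hd ih =>
    obtain ⟨ι, _, _, l, hl⟩ := ih
    by_cases h0 : d = 0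
    · refine ⟨ι, inferInstance, inferInstance, l, ?_⟩
      intro e he he0
      rcases Finset.mem_insert.1 he with rfl | he
      · exact absurd h0 he0
      · exact hl e he he0
    obtain ⟨γ, n, hn, hγn, hγ⟩ := exists_char d h0
    have : Nonempty (Fin n) := ⟨⟨0, hn⟩⟩
    refine ⟨ι × Fin n, inferInstance, inferInstance, fun p => l p.1 + (p.2 : ℕ) • γ, ?_⟩
    intro e he he0
    have key : ∑ p : ι × Fin n, ee ((l p.1 + (p.2 : ℕ) • γ) e) =
        (∑ i, ee (l i e)) * ∑ j ∈ Finset.range n, ee (γ e) ^ j := by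
      rw [Fintype.sum_prod_type, Finset.sum_mul, ← Fin.sum_univ_eq_sum_range (fun j => ee (γ e) ^ j)]
      refine Finset.sum_congr rfl fun i _ => ?_
      rw [Finset.mul_sum]
      refine Finset.sum_congr rfl fun j _ => ?_
      rw [AddMonoidHom.add_apply, ee_add, AddMonoidHom.nsmul_apply, ee_nsmul]
    rw [key]
    rcases Finset.mem_insert.1 he with rfl | he
    · have h1 : ee (γ e) ≠ 1 := fun h => hγ (ee_eq_one h)
      rw [geom_sum_eq h1, ← ee_nsmul, hγn, ee_zero]
      simp
    · rw [hl e he he0, zero_mul]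

/-- Number of elements of `P` not in `P + y`. -/
def df {A : Type u} [AddCommGroup A] [DecidableEq A] (P : Finset A) (y : A) : ℕ :=
  (P.filter (fun p => p - y ∉ P)).card

noncomputable def fh {A : Type u} [AddCommGroup A] (P : Finset A) (γ : A →+ AddCircle (1 : ℝ)) : ℂ :=
  ∑ p ∈ P, ee (γ p)

lemma fh_sq {A : Type u} [AddCommGroup A] (P : Finset A) (γ : A →+ AddCircle (1 : ℝ)) :
    ((‖fh P γ‖ ^ 2 : ℝ) : ℂ) = ∑ q ∈ P ×ˢ P, ee (γ (q.1 - q.2)) := by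
  have h : ((‖fh P γ‖ ^ 2 : ℝ) : ℂ) = fh P γ * (starRingEnd ℂ) (fh P γ) := by
    rw [Complex.mul_conj, Complex.normSq_eq_norm_sq]
  rw [h, fh, map_sum, Finset.sum_mul_sum, Finset.sum_product]
  refine Finset.sum_congr rfl fun a _ => Finset.sum_congr rfl fun b _ => ?_
  rw [← ee_neg, ← ee_add, map_sub, sub_eq_add_neg]

lemma fh_shift {A : Type u} [AddCommGroup A] [DecidableEq A] (P : Finset A)
    (γ : A →+ AddCircle (1 : ℝ)) (y : A) :
    ‖fh P γ‖ * ‖ee (γ y) - 1‖ ≤ 2 * df P y := by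
  rw [← norm_mul]
  have hcard : (P.filter (fun p => p + y ∉ P)).card = df P y := by
    have h1 := Finset.card_filter_add_card_filter_not (s := P) (fun p => p + y ∈ P)
    have h2 := Finset.card_filter_add_card_filter_not (s := P) (fun p => p - y ∈ P)
    have h3 : (P.filter (fun p => p + y ∈ P)).card = (P.filter (fun p => p - y ∈ P)).card := by
      apply Finset.card_bij (fun p _ => p + y)
      · intro a ha; simp at ha ⊢; exact ⟨ha.2, ha.1⟩
      · intro a _ b _ h; exact add_right_cancel h
      · intro b hb; simp at hb; exact ⟨b - y, by simp [hb], by simp⟩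
    unfold df; omega
  have e1 : fh P γ * ee (γ y) = ∑ p ∈ P, ee (γ (p + y)) := by
    rw [fh, Finset.sum_mul]
    exact Finset.sum_congr rfl fun p _ => by rw [map_add, ee_add]
  have e2 : ∑ p ∈ P.filter (fun p => p + y ∈ P), ee (γ (p + y)) =
      ∑ p ∈ P.filter (fun p => p - y ∈ P), ee (γ p) := by
    apply Finset.sum_bij (fun p _ => p + y)
    · intro a ha; simp at ha ⊢; exact ⟨ha.2, ha.1⟩
    · intro a _ b _ h; exact add_right_cancel h
    · intro b hb; simp at hb; exact ⟨b - y, by simp [hb], by simp⟩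
    · intros; rfl
  have e3 : fh P γ * (ee (γ y) - 1) = ∑ p ∈ P.filter (fun p => p + y ∉ P), ee (γ (p + y)) -
      ∑ p ∈ P.filter (fun p => p - y ∉ P), ee (γ p) := by
    rw [mul_sub, e1, mul_one, fh, ← Finset.sum_filter_add_sum_filter_not P (fun p => p + y ∈ P),
      ← Finset.sum_filter_add_sum_filter_not P (fun p => p - y ∈ P) (fun p => ee (γ p)), e2]
    ring
  rw [e3]
  have n1 : ‖∑ p ∈ P.filter (fun p => p + y ∉ P), ee (γ (p + y))‖ ≤ df P y := by
    rw [← hcard]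
    refine (norm_sum_le _ _).trans ?_
    simp [ee_norm]
  have n2 : ‖∑ p ∈ P.filter (fun p => p - y ∉ P), ee (γ p)‖ ≤ df P y := by
    refine (norm_sum_le _ _).trans ?_
    simp [ee_norm, df]
  calc _ ≤ _ := norm_sub_le _ _
    _ ≤ 2 * (df P y : ℝ) := by linarith

lemma bogo {A : Type u} [AddCommGroup A] [DecidableEq A] (P : Finset A) (hP : P.Nonempty) (K : ℕ)
    (hK : (P + P).card ≤ K * P.card) (Y : Set A) (η ε : ℝ) (hη : 0 < η)
    (hε : ε ^ 2 * K < η ^ 2)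
    (hY : ∀ y ∈ Y, (df P y : ℝ) ≤ ε * P.card) (x : A)
    (hx : ∀ γ : A →+ AddCircle (1 : ℝ), (∀ y ∈ Y, ‖γ y‖ ≤ η) → ‖γ x‖ ≤ 1 / 8) :
    ∃ a ∈ P, ∃ b ∈ P, ∃ c ∈ P, ∃ d ∈ P, x = a + b - c - d := by
  by_contra hcon
  push Not at hcon
  have hn : (0 : ℝ) < P.card := by exact_mod_cast hP.card_pos
  have hKpos : (0 : ℝ) < K := by
    have : 0 < (P + P).card := (hP.add hP).card_pos
    rcases Nat.eq_zero_or_pos K with h | h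
    · subst h; omega
    · exact_mod_cast h
  let Q := (P ×ˢ P) ×ˢ (P ×ˢ P)
  let D : Finset A := Q.image (fun q => (q.1.1 - q.1.2) + (q.2.1 - q.2.2)) ∪
    Q.image (fun q => (q.1.1 - q.1.2) + (q.2.1 - q.2.2) + x) ∪
    (P ×ˢ P).image (fun q => q.1 - q.2)
  obtain ⟨ι, _, _, l, hl⟩ := char_family D
  have hι : (0 : ℝ) < Fintype.card ι := by exact_mod_cast Fintype.card_pos
  have f4 : ∀ γ : A →+ AddCircle (1 : ℝ), ((‖fh P γ‖ ^ 4 : ℝ) : ℂ) =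
      ∑ q ∈ Q, ee (γ ((q.1.1 - q.1.2) + (q.2.1 - q.2.2))) := by
    intro γ
    have : ((‖fh P γ‖ ^ 4 : ℝ) : ℂ) = ((‖fh P γ‖ ^ 2 : ℝ) : ℂ) * ((‖fh P γ‖ ^ 2 : ℝ) : ℂ) := by
      push_cast; ring
    rw [this, fh_sq, Finset.sum_mul_sum, ← Finset.sum_product']
    refine Finset.sum_congr rfl fun a _ => ?_
    rw [← ee_add, ← map_add]
  have S1 : ∑ i, ‖fh P (l i)‖ ^ 4 * (ee (l i x)).re = 0 := by
    have h : ∑ i, ((‖fh P (l i)‖ ^ 4 : ℝ) : ℂ) * ee (l i x) = 0 := by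
      simp_rw [f4, Finset.sum_mul]
      rw [Finset.sum_comm]
      apply Finset.sum_eq_zero
      intro q hq
      simp_rw [← ee_add, ← map_add]
      apply hl
      · simp only [D, Finset.mem_union, Finset.mem_image]
        exact Or.inl (Or.inr ⟨q, hq, rfl⟩)
      · intro h0
        simp only [Q, Finset.mem_product] at hq
        apply hcon q.1.2 hq.1.2 q.2.2 hq.2.2 q.1.1 hq.1.1 q.2.1 hq.2.1
        have := eq_neg_of_add_eq_zero_right h0
        rw [this]; abel
    have h' := congrArg Complex.re h
    rw [Complex.re_sum] at h'
    simp only [Complex.re_ofReal_mul, Complex.zero_re] at h'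
    exact h'
  have S2 : (Fintype.card ι : ℝ) * P.card ^ 3 ≤ K * ∑ i, ‖fh P (l i)‖ ^ 4 := by
    have h : ((∑ i, ‖fh P (l i)‖ ^ 4 : ℝ) : ℂ) =
        (Fintype.card ι : ℂ) * ((Q.filter (fun q => (q.1.1 - q.1.2) + (q.2.1 - q.2.2) = 0)).card : ℂ) := by
      push_cast
      have f4' := f4
      push_cast at f4'
      simp_rw [f4']
      rw [Finset.sum_comm, Finset.card_filter]
      push_cast
      rw [Finset.mul_sum]
      refine Finset.sum_congr rfl fun q hq => ?_
      split_ifs with h0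
      · simp [h0, ee_zero]
      · rw [mul_zero]
        apply hl _ _ h0
        simp only [D, Finset.mem_union, Finset.mem_image]
        exact Or.inl (Or.inl ⟨q, hq, rfl⟩)
    have h2 : (∑ i, ‖fh P (l i)‖ ^ 4 : ℝ) =
        (Fintype.card ι : ℝ) * ((Q.filter (fun q => (q.1.1 - q.1.2) + (q.2.1 - q.2.2) = 0)).card : ℝ) := by
      exact_mod_cast h
    have h3 : (Q.filter (fun q => (q.1.1 - q.1.2) + (q.2.1 - q.2.2) = 0)).card = Finset.addEnergy P P := by
      rw [Finset.addEnergy]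
      congr 1
      apply Finset.filter_congr
      intro q _
      rw [← sub_eq_zero (a := q.1.1 + q.2.1)]
      rw [show q.1.1 + q.2.1 - (q.1.2 + q.2.2) = q.1.1 - q.1.2 + (q.2.1 - q.2.2) by abel]
    have h4 : P.card ^ 2 * P.card ^ 2 ≤ (P + P).card * Finset.addEnergy P P :=
      Finset.le_card_add_mul_addEnergy P P
    have h5 : P.card ^ 2 * P.card ^ 2 ≤ K * P.card * Finset.addEnergy P P :=
      h4.trans (Nat.mul_le_mul_right _ hK)
    have h6 : P.card ^ 3 ≤ K * Finset.addEnergy P P := by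
      have hp := hP.card_pos
      nlinarith
    rw [h2, h3]
    have h7 : (P.card : ℝ) ^ 3 ≤ K * Finset.addEnergy P P := by exact_mod_cast h6
    nlinarith
  have S3 : ∑ i, ‖fh P (l i)‖ ^ 2 = (Fintype.card ι : ℝ) * P.card := by
    have h : ((∑ i, ‖fh P (l i)‖ ^ 2 : ℝ) : ℂ) = (Fintype.card ι : ℂ) * (P.card : ℂ) := by
      have f2 := fh_sq P
      push_cast at f2 ⊢
      simp_rw [f2]
      rw [Finset.sum_comm]
      have : ∀ q ∈ P ×ˢ P, ∑ i, ee (l i (q.1 - q.2)) = if q.1 = q.2 then (Fintype.card ι : ℂ) else 0 := by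
        intro q hq
        split_ifs with h0
        · simp [h0, ee_zero]
        · apply hl _ _ (sub_ne_zero.2 h0)
          simp only [D, Finset.mem_union, Finset.mem_image]
          exact Or.inr ⟨q, hq, rfl⟩
      rw [Finset.sum_congr rfl this, Finset.sum_product]
      simp [mul_comm]
    exact_mod_cast h
  have pt : ∀ i, (1 / 2) * ‖fh P (l i)‖ ^ 4 - (3 / 2) * (P.card ^ 2 / (4 * K)) * ‖fh P (l i)‖ ^ 2
      ≤ ‖fh P (l i)‖ ^ 4 * (ee (l i x)).re := by
    intro i
    set F := ‖fh P (l i)‖ with hF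
    have hF0 : 0 ≤ F := norm_nonneg _
    by_cases hg : ∀ y ∈ Y, ‖l i y‖ ≤ η
    · have := ee_re _ (hx (l i) hg)
      have : F ^ 4 * (1 / 2) ≤ F ^ 4 * (ee (l i x)).re := by gcongr
      have : 0 ≤ (3 / 2) * ((P.card : ℝ) ^ 2 / (4 * K)) * F ^ 2 := by positivity
      linarith
    · push Not at hg
      obtain ⟨y, hy, hyη⟩ := hg
      have h1 := fh_shift P (l i) y
      have h2 := ee_sub_one (l i y)
      have h3 := hY y hy
      have h4 : F * (4 * η) ≤ 2 * (ε * P.card) := by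
        calc F * (4 * η) ≤ F * ‖ee (l i y) - 1‖ := by gcongr; linarith
          _ ≤ _ := by linarith
      have h5 : F ^ 2 * (4 * K) ≤ P.card ^ 2 := by
        have h6 : 2 * F * η ≤ ε * P.card := by linarith
        have h7 : (2 * F * η) ^ 2 ≤ (ε * P.card) ^ 2 := by gcongr
        have h8 : (2 * F * η) ^ 2 * K ≤ (ε * P.card) ^ 2 * K := by gcongr
        have h9 : (ε * P.card) ^ 2 * K ≤ η ^ 2 * P.card ^ 2 := by
          have : ε ^ 2 * K * P.card ^ 2 ≤ η ^ 2 * P.card ^ 2 := by gcongr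
          nlinarith
        have h10 : η ^ 2 * (F ^ 2 * (4 * K)) ≤ η ^ 2 * P.card ^ 2 := by nlinarith
        exact le_of_mul_le_mul_left h10 (by positivity)
      have h6 : F ^ 2 ≤ P.card ^ 2 / (4 * K) := by
        rw [le_div_iff₀ (by positivity)]; exact h5
      have h7 : F ^ 4 ≤ (P.card ^ 2 / (4 * K)) * F ^ 2 := by
        have : F ^ 4 = F ^ 2 * F ^ 2 := by ring
        rw [this]; gcongr
      have h8 : -1 ≤ (ee (l i x)).re := by
        have := Complex.abs_re_le_norm (ee (l i x))
        rw [ee_norm] at this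
        exact (abs_le.1 this).1
      have : F ^ 4 * (-1) ≤ F ^ 4 * (ee (l i x)).re := by gcongr
      linarith
  have tot := Finset.sum_le_sum (fun i (_ : i ∈ (Finset.univ : Finset ι)) => pt i)
  rw [S1, Finset.sum_sub_distrib, ← Finset.mul_sum, ← Finset.mul_sum, S3] at tot
  have : (3 / 2) * ((P.card : ℝ) ^ 2 / (4 * K)) * (Fintype.card ι * P.card) =
      (3 / 8) * (Fintype.card ι * P.card ^ 3) / K := by field_simp; ring
  rw [this] at tot
  have h1 : (Fintype.card ι : ℝ) * P.card ^ 3 / K ≤ ∑ i, ‖fh P (l i)‖ ^ 4 := by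
    rw [div_le_iff₀ hKpos]; linarith
  have h2 : 0 < (Fintype.card ι : ℝ) * P.card ^ 3 / K := by positivity
  have h3 : (3 / 8) * ((Fintype.card ι : ℝ) * P.card ^ 3) / K = (3 / 8) * ((Fintype.card ι : ℝ) * P.card ^ 3 / K) := by ring
  linarith

/-- `j`-fold sumset. -/
def sm {A : Type u} [AddCommGroup A] [DecidableEq A] (W : Finset A) : ℕ → Finset A
  | 0 => {0}
  | j + 1 => sm W j + W

section smsec
variable {A : Type u} [AddCommGroup A] [DecidableEq A]

lemma sm_add {W : Finset A} (i : ℕ) {x : A} (hx : x ∈ sm W i) (j : ℕ) :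
    ∀ {y : A}, y ∈ sm W j → x + y ∈ sm W (i + j) := by
  induction j with
  | zero => intro y hy; simp [sm] at hy; simpa [hy] using hx
  | succ j ih =>
    intro y hy
    obtain ⟨a, ha, b, hb, rfl⟩ := Finset.mem_add.1 hy
    rw [← add_assoc x a b]
    have := Finset.add_mem_add (ih ha) hb
    exact this

lemma sm_one {W : Finset A} {x : A} (hx : x ∈ W) : x ∈ sm W 1 := by
  have : (0 : A) + x ∈ sm W 0 + W := Finset.add_mem_add (by simp [sm]) hx
  rw [zero_add] at this
  exact this

lemma sm_zero_mem {W : Finset A} (h0 : (0 : A) ∈ W) (j : ℕ) : (0 : A) ∈ sm W j := by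
  induction j with
  | zero => simp [sm]
  | succ j ih =>
    have : (0 : A) + 0 ∈ sm W j + W := Finset.add_mem_add ih h0
    rw [zero_add] at this
    exact this

lemma sm_le {W : Finset A} (h0 : (0 : A) ∈ W) {i j : ℕ} (hij : i ≤ j) {x : A} (hx : x ∈ sm W i) :
    x ∈ sm W j := by
  obtain ⟨k, rfl⟩ := Nat.exists_eq_add_of_le hij
  have := sm_add i hx k (sm_zero_mem h0 k)
  rwa [add_zero] at this

lemma sm_neg {W : Finset A} (hs : ∀ w ∈ W, -w ∈ W) (j : ℕ) :
    ∀ {x : A}, x ∈ sm W j → -x ∈ sm W j := by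
  induction j with
  | zero => intro x hx; simp [sm] at hx ⊢; exact hx
  | succ j ih =>
    intro x hx
    obtain ⟨a, ha, b, hb, rfl⟩ := Finset.mem_add.1 hx
    rw [neg_add]
    exact Finset.add_mem_add (ih ha) (hs _ hb)

lemma sm_sub {W : Finset A} (hs : ∀ w ∈ W, -w ∈ W) (i : ℕ) {x : A} (hx : x ∈ sm W i) (j : ℕ)
    {y : A} (hy : y ∈ sm W j) : x - y ∈ sm W (i + j) := by
  rw [sub_eq_add_neg]
  exact sm_add i hx j (sm_neg hs j hy)

lemma sm_double {W : Finset A} (j : ℕ) : ∀ {x : A}, x ∈ sm (W + W) j → x ∈ sm W (2 * j) := by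
  induction j with
  | zero => intro x hx; exact hx
  | succ j ih =>
    intro x hx
    obtain ⟨a, ha, b, hb, rfl⟩ := Finset.mem_add.1 hx
    obtain ⟨c, hc, d, hd, rfl⟩ := Finset.mem_add.1 hb
    exact sm_add (2 * j) (ih ha) 2 (sm_add 1 (sm_one hc) 1 (sm_one hd))

lemma sm_eq_nsmul (W : Finset A) (j : ℕ) : sm W j = (j • W : Finset A) := by
  induction j with
  | zero => rw [zero_nsmul]; rfl
  | succ j ih => rw [succ_nsmul, ← ih]; rfl

lemma df_zero (P : Finset A) : df P 0 = 0 := by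
  unfold df
  rw [Finset.card_eq_zero, Finset.filter_eq_empty_iff]
  intro p hp h
  exact h (by simpa using hp)

lemma df_add (P : Finset A) (x y : A) : df P (x + y) ≤ df P x + df P y := by
  unfold df
  have h : P.filter (fun p => p - (x + y) ∉ P) ⊆ P.filter (fun p => p - x ∉ P) ∪
      (P.filter (fun p => p - y ∉ P)).image (fun p => p + x) := by
    intro p hp
    rw [Finset.mem_filter] at hp
    rw [Finset.mem_union, Finset.mem_filter, Finset.mem_image]
    by_cases hx : p - x ∈ P
    · right
      refine ⟨p - x, ?_, by simp⟩
      rw [Finset.mem_filter]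
      exact ⟨hx, by rw [sub_sub]; exact hp.2⟩
    · left; exact ⟨hp.1, hx⟩
  have h1 := Finset.card_le_card h
  have h2 := Finset.card_union_le (P.filter (fun p => p - x ∉ P))
      ((P.filter (fun p => p - y ∉ P)).image (fun p => p + x))
  have h3 := Finset.card_image_le (s := P.filter (fun p => p - y ∉ P)) (f := fun p => p + x)
  omega

lemma df_sm (P S : Finset A) (δ : ℝ) (h : ∀ w ∈ S, (df P w : ℝ) ≤ δ) (n : ℕ) :
    ∀ {x : A}, x ∈ sm S n → (df P x : ℝ) ≤ n * δ := by
  induction n with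
  | zero => intro x hx; simp [sm] at hx; simp [hx, df_zero]
  | succ n ih =>
    intro x hx
    obtain ⟨a, ha, b, hb, rfl⟩ := Finset.mem_add.1 hx
    have h1 : (df P (a + b) : ℝ) ≤ df P a + df P b := by exact_mod_cast df_add P a b
    have h2 := ih ha
    have h3 := h b hb
    push_cast
    linarith

/-- `S` is covered by `c` translates of `B`. -/
def Cov (c : ℕ) (S B : Set A) : Prop :=
  ∃ F : Finset A, F.card ≤ c ∧ ∀ s ∈ S, ∃ f ∈ F, s - f ∈ B

set_option linter.unusedSectionVars false
lemma Cov.mono {c : ℕ} {S S' B : Set A} (h : Cov c S B) (hs : S' ⊆ S) : Cov c S' B := by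
  obtain ⟨F, hF, h⟩ := h
  exact ⟨F, hF, fun s hs' => h s (hs hs')⟩

lemma Cov.trans {c d : ℕ} {S B E : Set A} (h : Cov c S B) (h' : Cov d B E) : Cov (c * d) S E := by
  classical
  obtain ⟨F, hF, h⟩ := h
  obtain ⟨G, hG, h'⟩ := h'
  refine ⟨F + G, Finset.card_add_le.trans (Nat.mul_le_mul hF hG), fun s hs => ?_⟩
  obtain ⟨f, hf, hb⟩ := h s hs
  obtain ⟨g, hg, he⟩ := h' _ hb
  exact ⟨f + g, Finset.add_mem_add hf hg, by rwa [← sub_sub]⟩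

/-- Pigeonhole: simultaneous representatives. -/
lemma multi {ι : Type*} [Fintype ι] (S B : Set A) (φ : ι → A → A) (c : ℕ)
    (h : ∀ i, Cov c (φ i '' S) B) :
    ∃ F : Finset A, (∀ f ∈ F, f ∈ S) ∧ F.card ≤ c ^ Fintype.card ι ∧
      ∀ s ∈ S, ∃ f ∈ F, ∀ i, ∃ b ∈ B, ∃ b' ∈ B, φ i s - φ i f = b - b' := by
  classical
  choose G hG hcov using h
  rcases S.eq_empty_or_nonempty with rfl | hne
  · exact ⟨∅, by simp, by simp, by simp⟩
  have : Nonempty S := hne.to_subtype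
  have hc : ∀ s : S, ∀ i, ∃ f : G i, φ i s - f ∈ B := fun s i => by
    obtain ⟨f, hf, hb⟩ := hcov i (φ i s) ⟨s, s.2, rfl⟩
    exact ⟨⟨f, hf⟩, hb⟩
  choose col hcol using hc
  refine ⟨Finset.univ.image (fun k => ((Function.invFun col k : S) : A)), ?_, ?_, ?_⟩
  · intro f hf
    obtain ⟨k, _, rfl⟩ := Finset.mem_image.1 hf
    exact Subtype.property _
  · refine Finset.card_image_le.trans ?_
    rw [Finset.card_univ, Fintype.card_pi]
    simp only [Fintype.card_coe]
    exact Finset.prod_le_pow_card _ _ _ fun i _ => hG i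
  · intro s hs
    refine ⟨_, Finset.mem_image.2 ⟨col ⟨s, hs⟩, Finset.mem_univ _, rfl⟩, fun i => ?_⟩
    have he : col (Function.invFun col (col ⟨s, hs⟩)) = col ⟨s, hs⟩ :=
      Function.invFun_eq ⟨_, rfl⟩
    have h1 := hcol ⟨s, hs⟩ i
    have h2 := hcol (Function.invFun col (col ⟨s, hs⟩)) i
    rw [he] at h2
    exact ⟨_, h1, _, h2, by abel⟩

lemma cov_rep {c : ℕ} {S B : Set A} (h : Cov c S B) :
    ∃ F : Finset A, (∀ f ∈ F, f ∈ S) ∧ F.card ≤ c ∧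
      ∀ s ∈ S, ∃ f ∈ F, ∃ b ∈ B, ∃ b' ∈ B, s - f = b - b' := by
  obtain ⟨F, h1, h2, h3⟩ := multi (ι := Unit) S B (fun _ x => x) c (fun _ => by simpa using h)
  exact ⟨F, h1, by simpa using h2, fun s hs => by
    obtain ⟨f, hf, h⟩ := h3 s hs
    exact ⟨f, hf, h ()⟩⟩

/-- counting function -/
def rr (B : Finset A) (x : A) : ℕ := (B.filter (fun b => b - x ∈ B)).card

lemma rr_neg (B : Finset A) (x : A) : rr B (-x) = rr B x := by
  unfold rr
  apply Finset.card_bij (fun p _ => p + x)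
  · intro a ha; simp at ha ⊢; exact ⟨ha.2, ha.1⟩
  · intro a _ b _ h; exact add_right_cancel h
  · intro b hb; simp at hb; exact ⟨b - x, by simp [hb], by simp⟩

lemma rr_sum (B : Finset A) : ∑ x ∈ B - B, rr B x = B.card ^ 2 := by
  have h := Finset.card_eq_sum_card_fiberwise (s := B ×ˢ B) (t := B - B)
    (f := fun q : A × A => q.1 - q.2) (by
      intro q hq
      simp only [Finset.coe_product, Set.mem_prod, Finset.mem_coe] at hq
      exact Finset.sub_mem_sub hq.1 hq.2)
  rw [Finset.card_product, ← sq] at h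
  rw [h]
  refine Finset.sum_congr rfl fun x _ => ?_
  unfold rr
  apply Finset.card_bij (fun p _ => (p, p - x))
  · intro a ha; simp at ha ⊢; exact ha
  · intro a _ b _ h; exact (Prod.ext_iff.1 h).1
  · rintro ⟨a, b⟩ hb
    simp at hb
    obtain ⟨⟨h1, h2⟩, rfl⟩ := hb
    exact ⟨a, by simp [h1, h2], by simp⟩

lemma df_rr (P : Finset A) (x : A) : rr P x + df P x = P.card :=
  Finset.card_filter_add_card_filter_not (s := P) (fun p => p - x ∈ P)

end smsec

lemma sanders_ind (C N j : ℕ) (hN : 1 ≤ N) : ∀ t : ℝ, 0 < t → ∃ s₀ : ℝ, 0 < s₀ ∧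
    ∀ (A : Type u) [AddCommGroup A] [DecidableEq A] (X B : Finset A), X.Nonempty → B ⊆ X →
      (X - X).card ≤ C * X.card → t * X.card ≤ B.card →
      ((N : ℝ) / (N + 1)) ^ j * (B + X).card < X.card →
      ∃ S : Finset A, (∀ w ∈ S, -w ∈ S) ∧ (0 : A) ∈ S ∧
        (∀ x ∈ sm S N, x ∈ (X - X) + (X - X)) ∧ s₀ * X.card ≤ S.card := by
  induction j with
  | zero =>
    intro t ht
    refine ⟨1, one_pos, fun A _ _ X B hX hB hC htB h => ?_⟩
    exfalso
    have hXc : (0 : ℝ) < X.card := by exact_mod_cast hX.card_pos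
    have hB0 : 0 < B.card := by
      have : (0 : ℝ) < B.card := lt_of_lt_of_le (by positivity) htB
      exact_mod_cast this
    rw [pow_zero, one_mul] at h
    have h' : (B + X).card < X.card := by exact_mod_cast h
    have := Finset.card_le_card_add_left (Finset.card_pos.1 hB0) (t := X)
    omega
  | succ j ih =>
    intro t ht
    set s : ℝ := t ^ 2 / (2 * (C + 1)) with hs
    have hspos : 0 < s := by positivity
    obtain ⟨s₁, hs₁, ih⟩ := ih s hspos
    refine ⟨min (t / 2) s₁, lt_min (by positivity) hs₁, fun A _ _ X B hX hB hC htB h => ?_⟩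
    have hXc : (0 : ℝ) < X.card := by exact_mod_cast hX.card_pos
    have hBX : (B.card : ℝ) ≤ X.card := by exact_mod_cast Finset.card_le_card hB
    have ht1 : t ≤ 1 := by
      by_contra hcon
      push Not at hcon
      nlinarith
    have hBpos : (0 : ℝ) < B.card := lt_of_lt_of_le (by positivity) htB
    have hBne : B.Nonempty := Finset.card_pos.1 (by exact_mod_cast hBpos)
    set S : Finset A := (B - B).filter (fun x => s * X.card ≤ rr B x) with hS
    by_cases hcase : ∃ x ∈ S, ((B.filter (fun b => b - x ∈ B) + X).card : ℝ) <
        (N : ℝ) / (N + 1) * (B + X).card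
    · obtain ⟨x, hx, hlt⟩ := hcase
      rw [hS, Finset.mem_filter] at hx
      obtain ⟨S', h1, h2, h3, h4⟩ := ih A X (B.filter (fun b => b - x ∈ B)) hX
        ((Finset.filter_subset _ _).trans hB) hC hx.2 (by
          refine lt_of_le_of_lt ?_ h
          rw [pow_succ, mul_assoc]
          gcongr)
      refine ⟨S', h1, h2, h3, le_trans ?_ h4⟩
      gcongr
      exact min_le_right _ _
    · push Not at hcase
      have hsym : ∀ w ∈ S, -w ∈ S := by
        intro w hw
        rw [hS, Finset.mem_filter] at hw ⊢
        refine ⟨?_, by rw [rr_neg]; exact hw.2⟩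
        obtain ⟨a, ha, b, hb, rfl⟩ := Finset.mem_sub.1 hw.1
        rw [neg_sub]
        exact Finset.sub_mem_sub hb ha
      have hst : s ≤ t := by
        rw [hs, div_le_iff₀ (by positivity)]
        have : (0 : ℝ) ≤ C := Nat.cast_nonneg _
        nlinarith
      have h0 : (0 : A) ∈ S := by
        rw [hS, Finset.mem_filter]
        obtain ⟨b, hb⟩ := hBne
        refine ⟨Finset.mem_sub.2 ⟨b, hb, b, hb, sub_self b⟩, ?_⟩
        have : rr B 0 = B.card := by
          unfold rr
          congr 1
          rw [Finset.filter_eq_self]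
          intro a ha
          simpa using ha
        rw [this]
        refine le_trans ?_ htB
        gcongr
      refine ⟨S, hsym, h0, ?_, ?_⟩
      · set Q := B + X with hQ
        have hQpos : (0 : ℝ) < Q.card := by exact_mod_cast (hBne.add hX).card_pos
        have hdf : ∀ w ∈ S, (df Q w : ℝ) ≤ Q.card / (N + 1) := by
          intro w hw
          have h1 := hcase w hw
          have h2 : (B.filter (fun b => b - w ∈ B) + X) ⊆ Q.filter (fun p => p - w ∈ Q) := by
            intro p hp
            obtain ⟨b, hb, x, hx, rfl⟩ := Finset.mem_add.1 hp
            rw [Finset.mem_filter] at hb ⊢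
            refine ⟨Finset.add_mem_add hb.1 hx, ?_⟩
            rw [add_sub_right_comm]
            exact Finset.add_mem_add hb.2 hx
          have h3 := Finset.card_le_card h2
          have h4 := df_rr Q w
          have h5 : ((B.filter (fun b => b - w ∈ B) + X).card : ℝ) + df Q w ≤ Q.card := by
            have : (B.filter (fun b => b - w ∈ B) + X).card + df Q w ≤ Q.card := by
              rw [← h4]; exact Nat.add_le_add_right h3 _
            exact_mod_cast this
          have h6 : (Q.card : ℝ) / (N + 1) = Q.card - (N : ℝ) / (N + 1) * Q.card := by
            field_simp; ring
          linarith
        intro x hx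
        have h1 := df_sm Q S _ hdf N hx
        have h2 : (df Q x : ℝ) < Q.card := by
          refine lt_of_le_of_lt h1 ?_
          rw [mul_div_assoc', div_lt_iff₀ (by positivity)]
          nlinarith
        have h3 : 0 < rr Q x := by
          have := df_rr Q x
          have h2' : df Q x < Q.card := by exact_mod_cast h2
          omega
        obtain ⟨p, hp⟩ := Finset.card_pos.1 h3
        rw [Finset.mem_filter] at hp
        obtain ⟨a, ha, b, hb, hab⟩ := Finset.mem_add.1 hp.1
        obtain ⟨c, hc, d, hd, hcd⟩ := Finset.mem_add.1 hp.2
        have : x = (a - c) + (b - d) := by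
          have : x = (a + b) - (c + d) := by rw [hab, hcd]; abel
          rw [this]; abel
        rw [this]
        exact Finset.add_mem_add (Finset.sub_mem_sub (hB ha) (hB hc)) (Finset.sub_mem_sub hb hd)
      · have e1 := rr_sum B
        rw [← Finset.sum_filter_add_sum_filter_not (B - B) (fun x => s * X.card ≤ rr B x)] at e1
        have e1' : (∑ x ∈ S, (rr B x : ℝ)) +
            ∑ x ∈ (B - B).filter (fun x => ¬ s * X.card ≤ rr B x), (rr B x : ℝ) = (B.card : ℝ) ^ 2 := by
          exact_mod_cast e1
        have e2 : ∑ x ∈ S, (rr B x : ℝ) ≤ S.card * B.card := by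
          rw [← nsmul_eq_mul]
          apply Finset.sum_le_card_nsmul
          intro x _
          exact_mod_cast Finset.card_filter_le _ _
        have e3 : ∑ x ∈ (B - B).filter (fun x => ¬ s * X.card ≤ rr B x), (rr B x : ℝ) ≤
            (C * X.card) * (s * X.card) := by
          have : ∑ x ∈ (B - B).filter (fun x => ¬ s * X.card ≤ rr B x), (rr B x : ℝ) ≤
            ((B - B).filter (fun x => ¬ s * X.card ≤ rr B x)).card * (s * X.card) := by
            rw [← nsmul_eq_mul]
            apply Finset.sum_le_card_nsmul
            intro x hx
            rw [Finset.mem_filter] at hx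
            exact (not_le.1 hx.2).le
          refine this.trans ?_
          gcongr
          have h1 : ((B - B).filter (fun x => ¬ s * X.card ≤ rr B x)).card ≤ C * X.card :=
            (Finset.card_filter_le _ _).trans
              ((Finset.card_le_card (Finset.sub_subset_sub hB hB)).trans hC)
          exact_mod_cast h1
        have e4 : (C * X.card) * (s * X.card) ≤ (B.card : ℝ) ^ 2 / 2 := by
          have h1 : (C : ℝ) * s ≤ t ^ 2 / 2 := by
            rw [hs, mul_div_assoc', div_le_div_iff₀ (by positivity) (by positivity)]
            have : 0 ≤ t ^ 2 := by positivity
            nlinarith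
          have h2 : (t * X.card) ^ 2 ≤ (B.card : ℝ) ^ 2 := by gcongr
          have h3 : (C : ℝ) * s * (X.card) ^ 2 ≤ t ^ 2 / 2 * X.card ^ 2 := by gcongr
          nlinarith
        have e5 : (B.card : ℝ) / 2 ≤ S.card := by
          have : (B.card : ℝ) / 2 * B.card ≤ S.card * B.card := by nlinarith
          exact le_of_mul_le_mul_right this hBpos
        have e6 : min (t / 2) s₁ * X.card ≤ t / 2 * X.card := by
          gcongr; exact min_le_left _ _
        linarith

lemma sanders (C N : ℕ) : ∃ c : ℕ,
    ∀ (A : Type u) [AddCommGroup A] [DecidableEq A] (X : Finset A), X.Nonempty →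
      (X - X).card ≤ C * X.card → (X + X).card ≤ C * X.card →
      ((X - X) + (X - X) + (X - X)).card ≤ C * X.card →
      ∃ W : Finset A, (∀ w ∈ W, -w ∈ W) ∧ (0 : A) ∈ W ∧
        (∀ x ∈ sm W N, x ∈ (X - X) + (X - X)) ∧ Cov c (↑(X - X) : Set A) (↑W : Set A) := by
  obtain ⟨j, hj⟩ := exists_pow_lt_of_lt_one (x := (1 : ℝ) / (C + 1))
    (y := ((2 * (N + 1) : ℕ) : ℝ) / ((2 * (N + 1) : ℕ) + 1)) (by positivity) (by
      rw [div_lt_one (by positivity)]; linarith)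
  obtain ⟨s₀, hs₀, h⟩ := sanders_ind.{u} C (2 * (N + 1)) j (by omega) 1 one_pos
  refine ⟨⌈(C : ℝ) / s₀⌉₊, fun A _ _ X hX h1 h2 h3 => ?_⟩
  have hXc : (0 : ℝ) < X.card := by exact_mod_cast hX.card_pos
  obtain ⟨S, hsym, h0, hsm, hcard⟩ := h A X X hX (Finset.Subset.refl _) h1 (by simp) (by
    have h2' : ((X + X).card : ℝ) ≤ C * X.card := by exact_mod_cast h2
    have : ((2 * (N + 1) : ℕ) / ((2 * (N + 1) : ℕ) + 1) : ℝ) ^ j * (X + X).card ≤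
        1 / (C + 1) * (C * X.card) := by gcongr
    refine lt_of_le_of_lt this ?_
    rw [div_mul_eq_mul_div, div_lt_iff₀ (by positivity)]
    linarith)
  have hSne : S.Nonempty := ⟨0, h0⟩
  have hcov := Finset.ruzsa_covering_add (A := X - X) (B := S) (K := (C : ℝ) / s₀) hSne (by
    have hsub : (X - X) + S ⊆ (X - X) + (X - X) + (X - X) := by
      intro x hx
      obtain ⟨a, ha, b, hb, rfl⟩ := Finset.mem_add.1 hx
      have hb' := hsm b (sm_le h0 (by omega) (sm_one hb))
      obtain ⟨c, hc, d, hd, rfl⟩ := Finset.mem_add.1 hb'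
      rw [← add_assoc]
      exact Finset.add_mem_add (Finset.add_mem_add ha hc) hd
    have h4 : (((X - X) + S).card : ℝ) ≤ C * X.card := by
      exact_mod_cast (Finset.card_le_card hsub).trans h3
    refine h4.trans ?_
    rw [div_mul_eq_mul_div, le_div_iff₀ hs₀]
    have : (0 : ℝ) ≤ C := Nat.cast_nonneg _
    nlinarith)
  obtain ⟨F, hF, hFc, hcov⟩ := hcov
  refine ⟨S + S, ?_, ?_, ?_, F, ?_, ?_⟩
  · intro w hw
    obtain ⟨a, ha, b, hb, rfl⟩ := Finset.mem_add.1 hw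
    rw [neg_add]
    exact Finset.add_mem_add (hsym a ha) (hsym b hb)
  · have := Finset.add_mem_add h0 h0
    rwa [add_zero] at this
  · intro x hx
    exact hsm x (sm_le h0 (by omega) (sm_double N hx))
  · exact_mod_cast hFc.trans (Nat.le_ceil _)
  · intro x hx
    obtain ⟨f, hf, b, hb, rfl⟩ := Finset.mem_add.1 (hcov (Finset.mem_coe.1 hx))
    obtain ⟨c, hc, d, hd, rfl⟩ := Finset.mem_sub.1 hb
    refine ⟨f, hf, ?_⟩
    rw [add_sub_cancel_left, sub_eq_add_neg]
    exact Finset.mem_coe.2 (Finset.add_mem_add hc (hsym d hd))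

section dsec
variable {R : Type u} [NonUnitalRing R] [DecidableEq R]

/-- `4Z + Z * 4Z` for `Z = X - X`. -/
def DD (X : Finset R) : Finset R :=
  ((X - X) + (X - X) + (X - X) + (X - X)) + (X - X) * ((X - X) + (X - X) + (X - X) + (X - X))

lemma Z_zero {X : Finset R} (hX : X.Nonempty) : (0 : R) ∈ X - X := by
  obtain ⟨x, hx⟩ := hX
  exact Finset.mem_sub.2 ⟨x, hx, x, hx, sub_self x⟩

lemma Z_two {X : Finset R} (hX : X.Nonempty) {x : R} (h : x ∈ X - X) : x ∈ (X - X) + (X - X) := by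
  have := Finset.add_mem_add h (Z_zero hX)
  rwa [add_zero] at this

lemma Z_four {X : Finset R} {x y : R} (h : x ∈ (X - X) + (X - X)) (h' : y ∈ (X - X) + (X - X)) :
    x + y ∈ (X - X) + (X - X) + (X - X) + (X - X) := by
  have := Finset.add_mem_add h h'
  rwa [← add_assoc (X - X + (X - X))] at this

lemma Z_four' {X : Finset R} (hX : X.Nonempty) {x : R} (h : x ∈ (X - X) + (X - X)) :
    x ∈ (X - X) + (X - X) + (X - X) + (X - X) := by
  have := Z_four h (Z_two hX (Z_zero hX))
  rwa [add_zero] at this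

lemma D_mem {X : Finset R} {u z v : R} (hu : u ∈ (X - X) + (X - X) + (X - X) + (X - X))
    (hz : z ∈ X - X) (hv : v ∈ (X - X) + (X - X) + (X - X) + (X - X)) : u + z * v ∈ DD X :=
  Finset.add_mem_add hu (Finset.mul_mem_mul hz hv)

lemma D_mem1 {X : Finset R} (hX : X.Nonempty) {u : R}
    (hu : u ∈ (X - X) + (X - X) + (X - X) + (X - X)) : u ∈ DD X := by
  have := D_mem hu (Z_zero hX) (Z_four' hX (Z_two hX (Z_zero hX)))
  rwa [mul_zero, add_zero] at this

lemma D_mem2 {X : Finset R} (hX : X.Nonempty) {z v : R}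
    (hz : z ∈ X - X) (hv : v ∈ (X - X) + (X - X) + (X - X) + (X - X)) : z * v ∈ DD X := by
  have := D_mem (Z_four' hX (Z_two hX (Z_zero hX))) hz hv
  rwa [zero_add] at this

lemma D_memZ {X : Finset R} (hX : X.Nonempty) {u : R} (hu : u ∈ X - X) : u ∈ DD X :=
  D_mem1 hX (Z_four' hX (Z_two hX hu))

lemma sm_diff (B : Finset R) (j : ℕ) : ∀ {x : R}, x ∈ sm (B - B) j → x ∈ sm B j - sm B j := by
  induction j with
  | zero => intro x hx; simpa [sm] using hx
  | succ j ih =>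
    intro x hx
    obtain ⟨a, ha, b, hb, rfl⟩ := Finset.mem_add.1 hx
    obtain ⟨c, hc, d, hd, rfl⟩ := Finset.mem_sub.1 (ih ha)
    obtain ⟨e, he, f, hf, rfl⟩ := Finset.mem_sub.1 hb
    refine Finset.mem_sub.2 ⟨c + e, Finset.add_mem_add hc he, d + f, Finset.add_mem_add hd hf, ?_⟩
    abel

lemma L1 (X : Finset R) (hX : X.Nonempty) (K : ℕ) (h : (X + X + X * X).card ≤ K * X.card) :
    (X + X + DD X).card ≤ K ^ 28 * X.card := by
  obtain ⟨x₀, hx₀⟩ := id hX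
  set B := X + X * X with hB
  set E := B - B with hE
  have hXXne : (X * X).Nonempty := hX.mul hX
  have hEs : ∀ w ∈ E, -w ∈ E := by
    intro w hw
    obtain ⟨a, ha, b, hb, rfl⟩ := Finset.mem_sub.1 hw
    rw [neg_sub]; exact Finset.sub_mem_sub hb ha
  have hE0 : (0 : R) ∈ E := Z_zero (hX.add hXXne)
  have hZ : ∀ z ∈ X - X, z ∈ sm E 1 := by
    intro z hz
    obtain ⟨a, ha, b, hb, rfl⟩ := Finset.mem_sub.1 hz
    obtain ⟨m, hm⟩ := hXXne
    apply sm_one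
    refine Finset.mem_sub.2 ⟨a + m, Finset.add_mem_add ha hm, b + m, Finset.add_mem_add hb hm, ?_⟩
    abel
  have hXX : ∀ a ∈ X * X, ∀ b ∈ X * X, a - b ∈ sm E 1 := by
    intro a ha b hb
    apply sm_one
    refine Finset.mem_sub.2 ⟨x₀ + a, Finset.add_mem_add hx₀ ha, x₀ + b, Finset.add_mem_add hx₀ hb, ?_⟩
    abel
  have hZZ : ∀ y ∈ X - X, ∀ z ∈ X - X, y * z ∈ sm E 2 := by
    intro y hy z hz
    obtain ⟨a, ha, b, hb, rfl⟩ := Finset.mem_sub.1 hy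
    obtain ⟨c, hc, d, hd, rfl⟩ := Finset.mem_sub.1 hz
    have e : (a - b) * (c - d) = (a * c - a * d) + (b * d - b * c) := by
      rw [sub_mul, mul_sub, mul_sub]; abel
    rw [e]
    exact sm_add 1 (hXX _ (Finset.mul_mem_mul ha hc) _ (Finset.mul_mem_mul ha hd)) 1
      (hXX _ (Finset.mul_mem_mul hb hd) _ (Finset.mul_mem_mul hb hc))
  have hsub : X + X + DD X ⊆ (sm E 14).image (fun y => x₀ + x₀ + y) := by
    intro y hy
    obtain ⟨s, hs, d, hd, rfl⟩ := Finset.mem_add.1 hy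
    obtain ⟨a, ha, b, hb, rfl⟩ := Finset.mem_add.1 hs
    obtain ⟨u, hu, m, hm, rfl⟩ := Finset.mem_add.1 hd
    obtain ⟨z, hz, v, hv, rfl⟩ := Finset.mem_mul.1 hm
    obtain ⟨u', hu', u4, hu4, rfl⟩ := Finset.mem_add.1 hu
    obtain ⟨u'', hu'', u3, hu3, rfl⟩ := Finset.mem_add.1 hu'
    obtain ⟨u1, hu1, u2, hu2, rfl⟩ := Finset.mem_add.1 hu''
    obtain ⟨v', hv', v4, hv4, rfl⟩ := Finset.mem_add.1 hv
    obtain ⟨v'', hv'', v3, hv3, rfl⟩ := Finset.mem_add.1 hv'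
    obtain ⟨v1, hv1, v2, hv2, rfl⟩ := Finset.mem_add.1 hv''
    have k1 := sm_add 1 (hZ _ (Finset.sub_mem_sub ha hx₀)) 1 (hZ _ (Finset.sub_mem_sub hb hx₀))
    have k2 := sm_add _ (sm_add _ (sm_add 1 (hZ _ hu1) 1 (hZ _ hu2)) 1 (hZ _ hu3)) 1 (hZ _ hu4)
    have k3 := sm_add _ (sm_add _ (sm_add 2 (hZZ _ hz _ hv1) 2 (hZZ _ hz _ hv2)) 2 (hZZ _ hz _ hv3)) 2
      (hZZ _ hz _ hv4)
    have k4 := sm_add _ k1 _ (sm_add _ k2 _ k3)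
    refine Finset.mem_image.2 ⟨_, k4, ?_⟩
    simp only [mul_add]
    abel
  have h1 : (X + X + DD X).card ≤ (sm E 14).card := (Finset.card_le_card hsub).trans Finset.card_image_le
  have h2 : (sm E 14).card ≤ (sm B 14 - sm B 14).card := Finset.card_le_card fun x hx => sm_diff B 14 hx
  have h3 := Finset.pluennecke_ruzsa_inequality_nsmul_sub_nsmul_add hX B 14 14
  rw [← sm_eq_nsmul] at h3
  have h4 : (((X + B).card : ℚ≥0) / X.card) ≤ K := by
    have hXc : (0 : ℚ≥0) < X.card := by exact_mod_cast hX.card_pos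
    rw [div_le_iff₀ hXc, hB, ← add_assoc]
    exact_mod_cast h
  have h5 : (((sm B 14 - sm B 14).card : ℕ) : ℚ≥0) ≤ K ^ 28 * X.card := by
    refine h3.trans ?_
    gcongr
  have h6 : (sm B 14 - sm B 14).card ≤ K ^ 28 * X.card := by exact_mod_cast h5
  omega

variable {X : Finset R} (hX : X.Nonempty) {C : ℕ} (hC : (X + X + DD X).card ≤ C * X.card)

lemma H_XD (hX : X.Nonempty) (hC : (X + X + DD X).card ≤ C * X.card) : (X + DD X).card ≤ C * X.card := by
  rw [add_assoc] at hC
  exact (Finset.card_le_card_add_left hX).trans hC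

lemma H_D (hX : X.Nonempty) (hC : (X + X + DD X).card ≤ C * X.card) : (DD X).card ≤ C * X.card :=
  (Finset.card_le_card_add_left hX).trans (H_XD hX hC)

lemma H_cov (hX : X.Nonempty) (hC : (X + X + DD X).card ≤ C * X.card) :
    Cov C (↑(DD X) : Set R) (↑(X - X) : Set R) := by
  have h := Finset.ruzsa_covering_add (A := DD X) (B := X) (K := (C : ℝ)) hX (by
    rw [add_comm]; exact_mod_cast H_XD hX hC)
  obtain ⟨F, _, hF, h⟩ := h
  refine ⟨F, by exact_mod_cast hF, fun x hx => ?_⟩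
  obtain ⟨f, hf, b, hb, rfl⟩ := Finset.mem_add.1 (h (Finset.mem_coe.1 hx))
  exact ⟨f, hf, by rw [add_sub_cancel_left]; exact Finset.mem_coe.2 hb⟩

end dsec

lemma L3 (C : ℕ) (ε : ℝ) (hε : 0 < ε) : ∃ c : ℕ, ∀ (R : Type u) [NonUnitalRing R] [DecidableEq R]
    (X : Finset R), X.Nonempty → (X + X + DD X).card ≤ C * X.card →
    ∃ (P : Finset R) (T : Set R), P.Nonempty ∧ (P + P).card ≤ C * P.card ∧
      (∀ a ∈ P, ∀ b ∈ P, ∀ c ∈ P, ∀ d ∈ P, a + b - c - d ∈ DD X) ∧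
      Cov c (↑(X - X) : Set R) T ∧
      (∀ t ∈ T, (df P t : ℝ) ≤ ε * P.card) ∧
      (∀ t ∈ T, ∀ z ∈ X - X, (df P (z * t) : ℝ) ≤ ε * P.card) := by
  obtain ⟨I, hI⟩ := pow_unbounded_of_one_lt (C : ℝ) (show 1 < 1 + ε by linarith)
  obtain ⟨N, hN⟩ : ∃ N : ℕ, N = 20 * (I + 1) := ⟨_, rfl⟩
  obtain ⟨c₀, hs⟩ := sanders.{u} C (2 * N)
  set cD := C * c₀ with hcD
  refine ⟨(cD + 1) ^ (C * 2 ^ cD + 1), fun R _ _ X hX hC => ?_⟩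
  have hXc : (0 : ℝ) < X.card := by exact_mod_cast hX.card_pos
  have hD := H_D hX hC
  have hXD := H_XD hX hC
  obtain ⟨W₀, hW₀s, hW₀0, hW₀sm, hW₀c⟩ := hs R X hX
    ((Finset.card_le_card fun x hx => D_memZ hX hx).trans hD)
    (by
      refine (Finset.card_le_card ?_).trans hC
      intro x hx
      have := Finset.add_mem_add hx (D_memZ hX (Z_zero hX))
      rwa [add_zero] at this)
    ((Finset.card_le_card fun x hx => by
      have := Finset.add_mem_add hx (Z_zero hX)
      rw [add_zero] at this
      exact D_mem1 hX this).trans hD)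
  have hDW : Cov cD (↑(DD X) : Set R) (↑W₀ : Set R) := (H_cov hX hC).trans hW₀c
  set W := W₀ + W₀ with hW
  have hWs : ∀ w ∈ W, -w ∈ W := by
    intro w hw
    obtain ⟨a, ha, b, hb, rfl⟩ := Finset.mem_add.1 hw
    rw [neg_add]
    exact Finset.add_mem_add (hW₀s a ha) (hW₀s b hb)
  have hW0 : (0 : R) ∈ W := by
    have := Finset.add_mem_add hW₀0 hW₀0
    rwa [add_zero] at this
  have hWd : ∀ b ∈ W₀, ∀ b' ∈ W₀, b - b' ∈ W := fun b hb b' hb' => by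
    rw [sub_eq_add_neg]; exact Finset.add_mem_add hb (hW₀s b' hb')
  have hWsm : ∀ j ≤ N, ∀ x ∈ sm W j, x ∈ (X - X) + (X - X) := fun j hj x hx =>
    hW₀sm x (sm_double (W := W₀) N (sm_le hW0 hj hx))
  have hW1 : ∀ w ∈ W, w ∈ (X - X) + (X - X) := fun w hw => hWsm 1 (by omega) w (sm_one hw)
  obtain ⟨F, -, hFc, hF⟩ := cov_rep hDW
  obtain ⟨p₁, hp₁⟩ := id hX
  classical
  let β : R → Finset R := fun p => F.filter (fun f => ∃ v ∈ W, ∃ v' ∈ W, (p - p₁) * v = f + v')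
  obtain ⟨y₀, -, hy₀⟩ := Finset.exists_le_card_fiber_of_nsmul_le_card_of_maps_to
    (s := X) (t := F.powerset) (f := β) (b := (X.card : ℝ) / F.powerset.card)
    (fun p _ => Finset.mem_powerset.2 (Finset.filter_subset _ _)) ⟨∅, by simp⟩ (by
      rw [nsmul_eq_mul]
      have : (F.powerset.card : ℝ) ≠ 0 := by
        rw [Finset.card_powerset]; positivity
      exact le_of_eq (mul_div_cancel₀ _ this))
  set Y := X.filter (fun x => β x = y₀) with hY
  have hYX : Y ⊆ X := Finset.filter_subset _ _
  have hYc : (X.card : ℝ) ≤ 2 ^ cD * Y.card := by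
    rw [Finset.card_powerset] at hy₀
    push_cast at hy₀
    rw [div_le_iff₀ (by positivity)] at hy₀
    calc (X.card : ℝ) ≤ Y.card * 2 ^ F.card := hy₀
      _ ≤ Y.card * 2 ^ cD := by gcongr; norm_num
      _ = _ := mul_comm _ _
  have hYne : Y.Nonempty := by
    rw [← Finset.card_pos]
    by_contra hcon
    have : Y.card = 0 := by omega
    rw [this, Nat.cast_zero, mul_zero] at hYc
    linarith
  obtain ⟨p₂, hp₂⟩ := id hYne
  set ζ := p₂ - p₁ with hζ
  have hζZ : ζ ∈ X - X := Finset.sub_mem_sub (hYX hp₂) hp₁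
  have key1 : ∀ p ∈ Y, ∀ w ∈ W, ∃ v ∈ W, ∃ u ∈ sm W 2, (p - p₁) * w = ζ * v + u := by
    intro p hp w hw
    have hpD : (p - p₁) * w ∈ DD X :=
      D_mem2 hX (Finset.sub_mem_sub (hYX hp) hp₁) (Z_four' hX (hW1 w hw))
    obtain ⟨f, hf, b, hb, b', hb', hbb⟩ := hF _ (Finset.mem_coe.2 hpD)
    have hbW := hWd b hb b' hb'
    have hfβ : f ∈ β p := by
      refine Finset.mem_filter.2 ⟨hf, w, hw, b - b', hbW, ?_⟩
      rw [← hbb]; abel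
    have hbb' : β p = β p₂ := by
      rw [(Finset.mem_filter.1 hp).2, (Finset.mem_filter.1 hp₂).2]
    rw [hbb'] at hfβ
    obtain ⟨-, v, hv, v', hv', e⟩ := Finset.mem_filter.1 hfβ
    refine ⟨v, hv, (b - b') - v', sm_sub hWs 1 (sm_one hbW) 1 (sm_one hv'), ?_⟩
    rw [hζ, e, ← hbb]; abel
  have key2 : ∀ p ∈ Y, ∀ p' ∈ Y, ∀ w ∈ W, ∃ v ∈ sm W 2, ∃ u ∈ sm W 4, (p - p') * w = ζ * v + u := by
    intro p hp p' hp' w hw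
    obtain ⟨v, hv, u, hu, e⟩ := key1 p hp w hw
    obtain ⟨v', hv', u', hu', e'⟩ := key1 p' hp' w hw
    refine ⟨v - v', sm_sub hWs 1 (sm_one hv) 1 (sm_one hv'), u - u', sm_sub hWs 2 hu 2 hu', ?_⟩
    have : (p - p') * w = (p - p₁) * w - (p' - p₁) * w := by
      rw [← sub_mul]; congr 1; abel
    rw [this, e, e', mul_sub]; abel
  have hcov := Finset.ruzsa_covering_add (A := X - X) (B := Y) (K := ((C * 2 ^ cD : ℕ) : ℝ)) hYne (by
    have h1 : (X - X) + Y ⊆ X + DD X := by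
      intro x hx
      obtain ⟨a, ha, b, hb, rfl⟩ := Finset.mem_add.1 hx
      have := Finset.add_mem_add (hYX hb) (D_memZ hX ha)
      rwa [add_comm b a] at this
    have h2 : (((X - X) + Y).card : ℝ) ≤ C * X.card := by
      exact_mod_cast (Finset.card_le_card h1).trans hXD
    push_cast
    refine h2.trans ?_
    rw [mul_assoc]
    gcongr)
  obtain ⟨G, hGZ, hGc, hG⟩ := hcov
  have hGc' : G.card ≤ C * 2 ^ cD := by exact_mod_cast hGc
  let T : Set R := {t | t ∈ W ∧ ∀ g ∈ G, g * t ∈ W}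
  have hT : Cov ((cD + 1) ^ (C * 2 ^ cD + 1)) (↑(X - X) : Set R) T := by
    obtain ⟨F', -, hF'c, hF'⟩ := multi (ι := Option G) (↑(X - X) : Set R) (↑W₀ : Set R)
      (fun i x => match i with
        | none => x
        | some g => (g : R) * x) cD (by
      rintro (_ | g)
      · apply hDW.mono
        rintro _ ⟨x, hx, rfl⟩
        exact Finset.mem_coe.2 (D_memZ hX (Finset.mem_coe.1 hx))
      · apply hDW.mono
        rintro _ ⟨x, hx, rfl⟩
        exact Finset.mem_coe.2 (D_mem2 hX (hGZ g.2) (Z_four' hX (Z_two hX (Finset.mem_coe.1 hx)))))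
    refine ⟨F', hF'c.trans ?_, ?_⟩
    · rw [Fintype.card_option, Fintype.card_coe]
      calc cD ^ (G.card + 1) ≤ (cD + 1) ^ (G.card + 1) := Nat.pow_le_pow_left (by omega) _
        _ ≤ _ := Nat.pow_le_pow_right (by omega) (by omega)
    · intro s hs
      obtain ⟨f, hf, h⟩ := hF' s hs
      refine ⟨f, hf, ?_, ?_⟩
      · obtain ⟨b, hb, b', hb', e⟩ := h none
        simp only at e
        rw [e]; exact hWd b hb b' hb'
      · intro g hg
        obtain ⟨b, hb, b', hb', e⟩ := h (some ⟨g, hg⟩)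
        simp only at e
        rw [mul_sub, e]; exact hWd b hb b' hb'
  have good2 : ∀ t ∈ T, ∀ z ∈ X - X, ∃ u ∈ sm W 5, ∃ v ∈ sm W 5, z * t = ζ * u + v := by
    intro t ht z hz
    obtain ⟨g, hg, q, hq, rfl⟩ := Finset.mem_add.1 (hG hz)
    obtain ⟨p, hp, p', hp', rfl⟩ := Finset.mem_sub.1 hq
    obtain ⟨v, hv, u, hu, e⟩ := key2 p hp p' hp' t ht.1
    refine ⟨v, sm_le hW0 (by omega) hv, g * t + u, sm_add 1 (sm_one (ht.2 g hg)) 4 hu, ?_⟩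
    rw [add_mul, e]; abel
  have good1 : ∀ t ∈ T, ∃ u ∈ sm W 5, ∃ v ∈ sm W 5, t = ζ * u + v := by
    intro t ht
    exact ⟨0, sm_zero_mem hW0 5, t, sm_le hW0 (by omega) (sm_one ht.1), by simp⟩
  let P : ℕ → Finset R := fun i => X + ((sm W (5 * i)).image (fun w => ζ * w) + sm W (5 * i))
  have hPmem : ∀ i x, x ∈ P i ↔ ∃ a ∈ X, ∃ u ∈ sm W (5 * i), ∃ v ∈ sm W (5 * i), x = a + ζ * u + v := by
    intro i x
    constructor
    · intro hx
      obtain ⟨a, ha, b, hb, rfl⟩ := Finset.mem_add.1 hx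
      obtain ⟨c, hc, v, hv, rfl⟩ := Finset.mem_add.1 hb
      obtain ⟨u, hu, rfl⟩ := Finset.mem_image.1 hc
      exact ⟨a, ha, u, hu, v, hv, by rw [add_assoc]⟩
    · rintro ⟨a, ha, u, hu, v, hv, rfl⟩
      rw [add_assoc]
      exact Finset.add_mem_add ha (Finset.add_mem_add (Finset.mem_image.2 ⟨u, hu, rfl⟩) hv)
  have hPX : ∀ i, X ⊆ P i := fun i x hx =>
    (hPmem i x).2 ⟨x, hx, 0, sm_zero_mem hW0 _, 0, sm_zero_mem hW0 _, by simp⟩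
  have hPstep : ∀ i, ∀ x ∈ P i, ∀ u ∈ sm W 5, ∀ v ∈ sm W 5, x + (ζ * u + v) ∈ P (i + 1) := by
    intro i x hx u hu v hv
    obtain ⟨a, ha, u', hu', v', hv', rfl⟩ := (hPmem i x).1 hx
    refine (hPmem _ _).2 ⟨a, ha, u' + u, ?_, v' + v, ?_, ?_⟩
    · rw [mul_add, mul_one]; exact sm_add _ hu' _ hu
    · rw [mul_add, mul_one]; exact sm_add _ hv' _ hv
    · rw [mul_add]; abel
  have hPsub : ∀ i, P i ⊆ P (i + 1) := by
    intro i x hx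
    have := hPstep i x hx 0 (sm_zero_mem hW0 _) 0 (sm_zero_mem hW0 _)
    simpa using this
  have hdf : ∀ i, ∀ u ∈ sm W 5, ∀ v ∈ sm W 5, df (P i) (ζ * u + v) + (P i).card ≤ (P (i + 1)).card := by
    intro i u hu v hv
    have h1 : ((P i).filter (fun p => p - (ζ * u + v) ∉ P i)).card ≤ (P (i + 1) \ P i).card := by
      apply Finset.card_le_card_of_injOn (fun p => p - (ζ * u + v))
      · intro p hp
        rw [Finset.mem_coe, Finset.mem_filter] at hp
        rw [Finset.mem_coe, Finset.mem_sdiff]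
        refine ⟨?_, hp.2⟩
        have := hPstep i p hp.1 (-u) (sm_neg hWs 5 hu) (-v) (sm_neg hWs 5 hv)
        rw [mul_neg, ← neg_add, ← sub_eq_add_neg] at this
        exact this
      · intro a _ b _ h
        exact sub_left_injective h
    have h2 := Finset.card_sdiff_add_card_eq_card (hPsub i)
    unfold df
    omega
  have hPXD : ∀ i ≤ I, P i ⊆ X + DD X := by
    intro i hi x hx
    obtain ⟨a, ha, u, hu, v, hv, rfl⟩ := (hPmem i x).1 hx
    have hu' := hWsm _ (by omega) u hu
    have hv' := hWsm _ (by omega) v hv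
    have := Finset.add_mem_add ha (D_mem (Z_four' hX hv') hζZ (Z_four' hX hu'))
    convert this using 1
    abel
  obtain ⟨i, hi, hPi⟩ : ∃ i < I, ((P (i + 1)).card : ℝ) ≤ (1 + ε) * (P i).card := by
    by_contra hcon
    push Not at hcon
    have h1 : ∀ i ≤ I, (1 + ε) ^ i * X.card ≤ ((P i).card : ℝ) := by
      intro i
      induction i with
      | zero => intro _; rw [pow_zero, one_mul]; exact_mod_cast Finset.card_le_card (hPX 0)
      | succ i ih =>
        intro hi
        have h2 := ih (by omega)
        have h3 := hcon i (by omega)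
        calc (1 + ε) ^ (i + 1) * X.card = (1 + ε) * ((1 + ε) ^ i * X.card) := by ring
          _ ≤ (1 + ε) * (P i).card := by gcongr
          _ ≤ _ := h3.le
    have h2 := h1 I le_rfl
    have h3 : ((P I).card : ℝ) ≤ C * X.card := by
      exact_mod_cast (Finset.card_le_card (hPXD I le_rfl)).trans hXD
    nlinarith
  have hdf' : ∀ u ∈ sm W 5, ∀ v ∈ sm W 5, (df (P i) (ζ * u + v) : ℝ) ≤ ε * (P i).card := by
    intro u hu v hv
    have h1 : (df (P i) (ζ * u + v) : ℝ) + (P i).card ≤ (P (i + 1)).card := by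
      exact_mod_cast hdf i u hu v hv
    linarith
  refine ⟨P i, T, ⟨p₁, hPX i hp₁⟩, ?_, ?_, hT, ?_, ?_⟩
  · have h1 : P i + P i ⊆ X + X + DD X := by
      intro x hx
      obtain ⟨y, hy, y', hy', rfl⟩ := Finset.mem_add.1 hx
      obtain ⟨a, ha, u, hu, v, hv, rfl⟩ := (hPmem i y).1 hy
      obtain ⟨a', ha', u', hu', v', hv', rfl⟩ := (hPmem i y').1 hy'
      have ku := hWsm _ (by omega) _ (sm_add _ hu _ hu')
      have kv := hWsm _ (by omega) _ (sm_add _ hv _ hv')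
      have := Finset.add_mem_add (Finset.add_mem_add ha ha') (D_mem (Z_four' hX kv) hζZ (Z_four' hX ku))
      convert this using 1
      rw [mul_add]; abel
    calc (P i + P i).card ≤ C * X.card := (Finset.card_le_card h1).trans hC
      _ ≤ _ := Nat.mul_le_mul_left _ (Finset.card_le_card (hPX i))
  · intro y1 hy1 y2 hy2 y3 hy3 y4 hy4
    obtain ⟨a1, ha1, u1, hu1, v1, hv1, rfl⟩ := (hPmem i y1).1 hy1
    obtain ⟨a2, ha2, u2, hu2, v2, hv2, rfl⟩ := (hPmem i y2).1 hy2
    obtain ⟨a3, ha3, u3, hu3, v3, hv3, rfl⟩ := (hPmem i y3).1 hy3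
    obtain ⟨a4, ha4, u4, hu4, v4, hv4, rfl⟩ := (hPmem i y4).1 hy4
    have ku := hWsm _ (by omega) _ (sm_sub hWs _ (sm_sub hWs _ (sm_add _ hu1 _ hu2) _ hu3) _ hu4)
    have kv := hWsm _ (by omega) _ (sm_sub hWs _ (sm_sub hWs _ (sm_add _ hv1 _ hv2) _ hv3) _ hv4)
    have ka := Finset.add_mem_add (Finset.sub_mem_sub ha1 ha3) (Finset.sub_mem_sub ha2 ha4)
    have := D_mem (Z_four ka kv) hζZ (Z_four' hX ku)
    convert this using 1
    simp only [mul_add, mul_sub]; abel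
  · intro t ht
    obtain ⟨u, hu, v, hv, e⟩ := good1 t ht
    rw [e]; exact hdf' u hu v hv
  · intro t ht z hz
    obtain ⟨u, hu, v, hv, e⟩ := good2 t ht z hz
    rw [e]; exact hdf' u hu v hv

lemma mulIter_comm {R : Type u} [NonUnitalRing R] (S : Set R) (n : ℕ) :
    mulIter S (n + 1) = S * mulIter S n := by
  induction n with
  | zero => rfl
  | succ n ih =>
    change mulIter S (n + 1) * S = S * (mulIter S n * S)
    rw [ih, mul_assoc]

lemma clmul {R : Type u} [NonUnitalRing R] {S S' : Set R} {a b : R}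
    (ha : a ∈ AddSubgroup.closure S) (hb : b ∈ AddSubgroup.closure S') :
    a * b ∈ AddSubgroup.closure (S * S') := by
  induction ha using AddSubgroup.closure_induction with
  | mem x hx =>
    induction hb using AddSubgroup.closure_induction with
    | mem y hy => exact AddSubgroup.subset_closure (Set.mul_mem_mul hx hy)
    | zero => rw [mul_zero]; exact zero_mem _
    | add y z _ _ h1 h2 => rw [mul_add]; exact add_mem h1 h2
    | neg y _ h => rw [mul_neg]; exact neg_mem h
  | zero => rw [zero_mul]; exact zero_mem _
  | add y z _ _ h1 h2 => rw [add_mul]; exact add_mem h1 h2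
  | neg y _ h => rw [neg_mul]; exact neg_mem h

/-- generalized Bohr set -/
def VV {A : Type u} [AddCommGroup A] (Y : Set A) (η s : ℝ) : Set A :=
  {x | ∀ γ : A →+ AddCircle (1 : ℝ), (∀ y ∈ Y, ‖γ y‖ ≤ η) → ‖γ x‖ ≤ s}

section vsec
variable {A : Type u} [AddCommGroup A] {Y : Set A} {η : ℝ}

lemma VV_mono {s s' : ℝ} (h : s ≤ s') {x : A} (hx : x ∈ VV Y η s) : x ∈ VV Y η s' :=
  fun γ hγ => (hx γ hγ).trans h

lemma VV_add {s s' : ℝ} {x y : A} (hx : x ∈ VV Y η s) (hy : y ∈ VV Y η s') :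
    x + y ∈ VV Y η (s + s') := fun γ hγ => by
  rw [map_add]
  exact (norm_add_le _ _).trans (add_le_add (hx γ hγ) (hy γ hγ))

lemma VV_neg {s : ℝ} {x : A} (hx : x ∈ VV Y η s) : -x ∈ VV Y η s := fun γ hγ => by
  rw [map_neg, norm_neg]; exact hx γ hγ

lemma VV_sub {s s' : ℝ} {x y : A} (hx : x ∈ VV Y η s) (hy : y ∈ VV Y η s') :
    x - y ∈ VV Y η (s + s') := by
  rw [sub_eq_add_neg]; exact VV_add hx (VV_neg hy)

lemma VV_half {s : ℝ} (hs : s ≤ 1 / 4) {x : A} (hx : x ∈ VV Y η s) (hxx : x + x ∈ VV Y η s) :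
    x ∈ VV Y η (s / 2) := fun γ hγ => by
  have h1 := hxx γ hγ
  rw [map_add, circ_double _ ((hx γ hγ).trans hs)] at h1
  linarith

lemma VV_self {x : A} (hx : x ∈ Y) : x ∈ VV Y η η := fun _ hγ => hγ x hx

end vsec

lemma L5 (C : ℕ) : ∃ L : ℕ, ∀ (R : Type u) [NonUnitalRing R] [DecidableEq R]
    (X : Finset R), X.Nonempty → (X + X + DD X).card ≤ C * X.card →
    ∃ R' I : Set R, IsSubringSet R' ∧ IsTwoSidedIdealIn I R' ∧ I ⊆ (↑(DD X) : Set R) ∧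
      (∃ m : ℕ, mulIter R' m ⊆ I) ∧ X.card ≤ L * ((↑(DD X) : Set R) ∩ R').ncard := by
  set ε : ℝ := 1 / (200 * (C + 1)) with hε
  have hεpos : 0 < ε := by positivity
  obtain ⟨c, hL3⟩ := L3.{u} C ε hεpos
  obtain ⟨c₃, hc₃⟩ : ∃ c₃, c₃ = C * c + C * (C * c) * (C * c) := ⟨_, rfl⟩
  refine ⟨(c₃ + 1) ^ (C * c + 1), fun R _ _ X hX hC => ?_⟩
  obtain ⟨P, T, hP, hPP, hPD, hTc, hT1, hT2⟩ := hL3 R X hX hC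
  set Y : Set R := {y | y ∈ T ∨ ∃ z ∈ X - X, ∃ t ∈ T, y = z * t} with hY
  set V : ℝ → Set R := VV Y (1 / 200) with hV
  have hVD : ∀ x ∈ V (1 / 8), x ∈ DD X := by
    intro x hx
    obtain ⟨a, ha, b, hb, c, hc, d, hd, rfl⟩ := bogo P hP C hPP Y (1 / 200) ε (by norm_num) (by
      rw [hε, div_pow, one_pow, div_mul_eq_mul_div, div_lt_iff₀ (by positivity)]
      have : (0 : ℝ) ≤ C := Nat.cast_nonneg _
      nlinarith) (by
      rintro y (hy | ⟨z, hz, t, ht, rfl⟩)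
      · exact hT1 y hy
      · exact hT2 t ht z hz) x hx
    exact hPD a ha b hb c hc d hd
  have hTV : ∀ t ∈ T, t ∈ V (1 / 200) := fun t ht => VV_self (Or.inl ht)
  have hZTV : ∀ z ∈ X - X, ∀ t ∈ T, z * t ∈ V (1 / 200) := fun z hz t ht =>
    VV_self (Or.inr ⟨z, hz, t, ht, rfl⟩)
  set S : Set R := {b | b ∈ V (1 / 8) ∧ ∀ x ∈ V (1 / 8), b * x ∈ V (1 / 16)} with hS
  have hSD : ∀ b ∈ S, b ∈ DD X := fun b hb => hVD b hb.1
  have hstep : ∀ j : ℕ, ∀ t ∈ S, ∀ u ∈ V (1 / 8 / 2 ^ j), t * u ∈ V (1 / 8 / 2 ^ (j + 1)) := by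
    intro j
    induction j with
    | zero =>
      intro t ht u hu
      have := ht.2 u (by simpa using hu)
      convert this using 2
      norm_num
    | succ j ih =>
      intro t ht u hu
      have e : (1 : ℝ) / 8 / 2 ^ (j + 1) + 1 / 8 / 2 ^ (j + 1) = 1 / 8 / 2 ^ j := by
        rw [pow_succ]; field_simp; norm_num
      have hpos : (0 : ℝ) ≤ 1 / 8 / 2 ^ (j + 1) := by positivity
      have h1 := ih t ht u (VV_mono (by linarith) hu)
      have huu := VV_add hu hu
      rw [e] at huu
      have h2 := ih t ht (u + u) huu
      rw [mul_add] at h2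
      have h3 := VV_half (by
        rw [div_div, div_le_div_iff₀ (by positivity) (by norm_num)]
        have : (1 : ℝ) ≤ 2 ^ (j + 1) := one_le_pow₀ (by norm_num)
        linarith) h1 h2
      convert h3 using 2
      rw [pow_succ _ (j + 1)]; field_simp
  have hSS : S * S ⊆ S := by
    rintro _ ⟨a, ha, b, hb, rfl⟩
    refine ⟨VV_mono (by norm_num) (ha.2 b hb.1), fun x hx => ?_⟩
    change a * b * x ∈ _
    rw [mul_assoc]
    exact ha.2 _ (VV_mono (by norm_num) (hb.2 x hx))
  have hDT : Cov (C * c) (↑(DD X) : Set R) T := (H_cov hX hC).trans hTc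
  have hScov : Cov ((c₃ + 1) ^ (C * c + 1)) (↑(X - X) : Set R) S := by
    obtain ⟨F, hFV, hFc, hF⟩ := cov_rep (hDT.mono (fun x hx => Finset.mem_coe.2 (hVD x hx)))
    obtain ⟨F', hF'Z, hF'c, hF'⟩ := multi (ι := Option F) (↑(X - X) : Set R) (V (1 / 100))
      (fun i x => match i with
        | none => x
        | some f => x * (f : R)) c₃ (by
      obtain ⟨F₂, hF₂c, hF₂⟩ := id hDT
      rintro (_ | ⟨f, hf⟩)
      · refine ⟨F₂, by omega, ?_⟩
        rintro _ ⟨x, hx, rfl⟩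
        obtain ⟨g, hg, h⟩ := hF₂ x (Finset.mem_coe.2 (D_memZ hX (Finset.mem_coe.1 hx)))
        exact ⟨g, hg, VV_mono (by norm_num) (hTV _ h)⟩
      · obtain ⟨d, hd, m, hm, rfl⟩ := Finset.mem_add.1 (hVD _ (hFV f hf))
        obtain ⟨z, hz, e, he, rfl⟩ := Finset.mem_mul.1 hm
        obtain ⟨F₁, hF₁c, hF₁⟩ := H_cov hX hC
        refine ⟨F₁.image (fun g => g * e) + F₂ + F₂, ?_, ?_⟩
        · have h1 : (F₁.image (fun g => g * e) + F₂ + F₂).card ≤ C * (C * c) * (C * c) :=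
            Finset.card_add_le.trans (Nat.mul_le_mul (Finset.card_add_le.trans
              (Nat.mul_le_mul (Finset.card_image_le.trans hF₁c) hF₂c)) hF₂c)
          omega
        · rintro _ ⟨b, hb, rfl⟩
          have hb := Finset.mem_coe.1 hb
          obtain ⟨f₁, hf₁, h1⟩ := hF₁ (b * z) (Finset.mem_coe.2
            (D_mem2 hX hb (Z_four' hX (Z_two hX hz))))
          obtain ⟨f₂, hf₂, h2⟩ := hF₂ _ (Finset.mem_coe.2 (D_mem2 hX (Finset.mem_coe.1 h1) he))
          obtain ⟨f₃, hf₃, h3⟩ := hF₂ _ (Finset.mem_coe.2 (D_mem2 hX hb hd))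
          refine ⟨f₁ * e + f₂ + f₃, Finset.add_mem_add (Finset.add_mem_add
            (Finset.mem_image.2 ⟨f₁, hf₁, rfl⟩) hf₂) hf₃, ?_⟩
          have h4 := VV_add (hTV _ h2) (hTV _ h3)
          have h5 := VV_mono (s' := 1 / 100) (by norm_num) h4
          convert h5 using 1
          change b * (d + z * e) - _ = _
          rw [mul_add, sub_mul, mul_assoc]; abel)
    refine ⟨F', hF'c.trans ?_, ?_⟩
    · rw [Fintype.card_option, Fintype.card_coe]
      calc c₃ ^ (F.card + 1) ≤ (c₃ + 1) ^ (F.card + 1) := Nat.pow_le_pow_left (by omega) _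
        _ ≤ _ := Nat.pow_le_pow_right (by omega) (by omega)
    · intro s hs
      obtain ⟨s₀, hs₀, h⟩ := hF' s hs
      refine ⟨s₀, hs₀, ?_, ?_⟩
      · obtain ⟨b, hb, b', hb', e⟩ := h none
        simp only at e
        rw [e]; exact VV_mono (by norm_num) (VV_sub hb hb')
      · intro x hx
        obtain ⟨f, hf, τ, hτ, τ', hτ', e⟩ := hF x hx
        obtain ⟨b, hb, b', hb', e'⟩ := h (some ⟨f, hf⟩)
        simp only at e'
        have hs' := Finset.mem_coe.1 hs
        have hs₀' := Finset.mem_coe.1 (hF'Z s₀ hs₀)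
        have e2 : (s - s₀) * x = (b - b') + ((s * τ - s₀ * τ) - (s * τ' - s₀ * τ')) := by
          have : x = f + (τ - τ') := by rw [← e]; abel
          rw [← e', this, ← sub_mul, ← sub_mul, ← sub_mul, mul_add, mul_sub]
        rw [e2]
        exact VV_mono (by norm_num) (VV_add (VV_sub hb hb')
          (VV_sub (VV_sub (hZTV s hs' τ hτ) (hZTV s₀ hs₀' τ hτ))
            (VV_sub (hZTV s hs' τ' hτ') (hZTV s₀ hs₀' τ' hτ'))))
  have hk : ∃ k : ℕ, ∀ x ∈ V (1 / 8 / 2 ^ k), x ∈ V 0 := by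
    have h1 : ∀ x : R, ∃ k : ℕ, x ∉ V 0 → x ∉ V (1 / 8 / 2 ^ k) := by
      intro x
      by_cases hx : x ∈ V 0
      · exact ⟨0, fun h => absurd hx h⟩
      · have hx' : ¬ ∀ γ : R →+ AddCircle (1 : ℝ), (∀ y ∈ Y, ‖γ y‖ ≤ 1 / 200) → ‖γ x‖ ≤ 0 := hx
        push Not at hx'
        obtain ⟨γ, hγ, hpos⟩ := hx'
        obtain ⟨k, hk⟩ := exists_pow_lt_of_lt_one hpos (show (1 / 2 : ℝ) < 1 by norm_num)
        refine ⟨k, fun _ h => ?_⟩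
        have h2 := h γ hγ
        have h3 : (1 : ℝ) / 8 / 2 ^ k ≤ (1 / 2) ^ k := by
          rw [div_pow, one_pow]
          gcongr
          norm_num
        linarith
    choose κ hκ using h1
    refine ⟨(DD X).sup κ, fun x hx => ?_⟩
    by_contra hcon
    have hxD : x ∈ DD X := hVD x (VV_mono (by
      apply div_le_self (by norm_num)
      exact one_le_pow₀ (by norm_num)) hx)
    refine hκ x hcon (VV_mono ?_ hx)
    have := Finset.le_sup (f := κ) hxD
    gcongr
    norm_num
  obtain ⟨k, hk⟩ := hk
  have hMV : ∀ n : ℕ, mulIter S n ⊆ V (1 / 8 / 2 ^ n) := by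
    intro n
    induction n with
    | zero => intro x hx; simpa using hx.1
    | succ n ih =>
      rw [mulIter_comm]
      rintro _ ⟨t, ht, u, hu, rfl⟩
      exact hstep n t ht u (ih hu)
  have hMsucc : ∀ n : ℕ, mulIter S (n + 1) ⊆ mulIter S n := by
    intro n
    induction n with
    | zero => exact hSS
    | succ n ih => exact Set.mul_subset_mul_right ih
  have hMS : ∀ n : ℕ, mulIter S n ⊆ S := by
    intro n
    induction n with
    | zero => exact subset_rfl
    | succ n ih => exact (hMsucc n).trans ih
  have hIV : ∀ x ∈ AddSubgroup.closure (mulIter S k), x ∈ V 0 := by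
    intro x hx
    induction hx using AddSubgroup.closure_induction with
    | mem x hx => exact hk x (hMV k hx)
    | zero => intro γ _; simp
    | add y z _ _ h1 h2 => exact VV_mono (by norm_num) (VV_add h1 h2)
    | neg y _ h => exact VV_neg h
  refine ⟨(AddSubgroup.closure S : Set R), (AddSubgroup.closure (mulIter S k) : Set R),
    ⟨zero_mem _, fun x hx y hy => add_mem hx hy, fun x hx => neg_mem hx, fun x hx y hy =>
      AddSubgroup.closure_mono hSS (clmul hx hy)⟩,
    ⟨AddSubgroup.closure_mono (hMS k), zero_mem _, fun x hx y hy => add_mem hx hy,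
      fun x hx => neg_mem hx, fun r hr x hx => ⟨?_, ?_⟩⟩, ?_, ⟨k, ?_⟩, ?_⟩
  · have := clmul hr hx
    rw [← mulIter_comm] at this
    exact AddSubgroup.closure_mono (hMsucc k) this
  · exact AddSubgroup.closure_mono (hMsucc k) (clmul hx hr)
  · intro x hx
    exact Finset.mem_coe.2 (hVD x (VV_mono (by norm_num) (hIV x hx)))
  · have : ∀ n, mulIter (AddSubgroup.closure S : Set R) n ⊆ AddSubgroup.closure (mulIter S n) := by
      intro n
      induction n with
      | zero => exact subset_rfl
      | succ n ih =>
        rintro _ ⟨a, ha, b, hb, rfl⟩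
        exact clmul (ih ha) hb
    exact this k
  · obtain ⟨F, hFc, hF⟩ := hScov
    classical
    set S' : Finset R := (DD X).filter (fun x => x ∈ S) with hS'
    have h1 : X - X ⊆ F + S' := by
      intro x hx
      obtain ⟨f, hf, h⟩ := hF x (Finset.mem_coe.2 hx)
      refine Finset.mem_add.2 ⟨f, hf, x - f, Finset.mem_filter.2 ⟨hSD _ h, h⟩, by abel⟩
    have h2 : X.card ≤ (X - X).card := Finset.card_le_card_sub_right hX
    have h3 : S'.card ≤ ((↑(DD X) : Set R) ∩ (AddSubgroup.closure S : Set R)).ncard := by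
      rw [← Set.ncard_coe_finset]
      apply Set.ncard_le_ncard
      · intro x hx
        have := Finset.mem_filter.1 (Finset.mem_coe.1 hx)
        exact ⟨Finset.mem_coe.2 this.1, AddSubgroup.subset_closure this.2⟩
      · exact (Finset.finite_toSet _).inter_of_left _
    calc X.card ≤ (X - X).card := h2
      _ ≤ (F + S').card := Finset.card_le_card h1
      _ ≤ F.card * S'.card := Finset.card_add_le
      _ ≤ _ := Nat.mul_le_mul hFc h3

lemma D_iter {R : Type u} [NonUnitalRing R] (Z : Set R) (h0 : (0 : R) ∈ Z) :
    (Z + Z + Z + Z) + Z * (Z + Z + Z + Z) ⊆ iterX Z 3 := by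
  have hz : ∀ n, (0 : R) ∈ iterX Z n ∧ ∀ x ∈ iterX Z n, ∀ y ∈ iterX Z n, x + y ∈ iterX Z (n + 1) := by
    intro n
    induction n with
    | zero =>
      refine ⟨h0, fun x hx y hy => ?_⟩
      have := Set.add_mem_add (Set.add_mem_add hx hy) (Set.mul_mem_mul h0 h0)
      rwa [mul_zero, add_zero] at this
    | succ n ih =>
      have hz : (0 : R) ∈ iterX Z (n + 1) := by
        have := ih.2 0 ih.1 0 ih.1
        rwa [add_zero] at this
      refine ⟨hz, fun x hx y hy => ?_⟩
      have := Set.add_mem_add (Set.add_mem_add hx hy) (Set.mul_mem_mul hz hz)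
      rwa [mul_zero, add_zero] at this
  have h4 : ∀ x ∈ Z + Z + Z + Z, x ∈ iterX Z 2 := by
    rintro _ ⟨_, ⟨_, ⟨a, ha, b, hb, rfl⟩, c, hc, rfl⟩, d, hd, rfl⟩
    change a + b + c + d ∈ _
    rw [add_assoc (a + b)]
    exact (hz 1).2 _ ((hz 0).2 a ha b hb) _ ((hz 0).2 c hc d hd)
  have h1 : ∀ x ∈ Z, x ∈ iterX Z 2 := by
    intro x hx
    have := (hz 1).2 _ ((hz 0).2 x hx 0 h0) _ (hz 1).1
    rwa [add_zero, add_zero] at this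
  rintro _ ⟨u, hu, _, ⟨z, hz', v, hv, rfl⟩, rfl⟩
  have := Set.add_mem_add (Set.add_mem_add (h4 u hu) (hz 2).1) (Set.mul_mem_mul (h1 z hz') (h4 v hv))
  rw [add_zero] at this
  exact this

lemma iter_fin {R : Type u} [NonUnitalRing R] (Z : Set R) (h : Z.Finite) (n : ℕ) :
    (iterX Z n).Finite := by
  induction n with
  | zero => exact h
  | succ n ih => exact (ih.add ih).add (ih.mul ih)


/-- Sum-product phenomenon in all rings, general form: given `g` with `n/g(n)` non-decreasing
and tending to infinity, there is a non-decreasing unbounded `f : ℕ → ℕ` such that for every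
finite nonempty subset `X` of a ring, with `Z := X - X`, either `|X+X+X·X| ≥ f(|X|)·|X|`, or
there are a subring `R'` and an ideal `I ⊴ R'` with `I ⊆ R' ∩ (4Z + Z·4Z)` (hence
`I ⊆ R' ∩ Z₃`), `R'/I` nilpotent, and `|Z₃ ∩ R'| ≥ g(|X|)`. -/
theorem stmt4 (g : ℕ → ℝ) (hg_pos : ∀ n, 0 < g n)
    (hg_mono : Monotone fun n : ℕ => (n : ℝ) / g n)
    (hg_tendsto : Filter.Tendsto (fun n : ℕ => (n : ℝ) / g n) Filter.atTop Filter.atTop) :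
    ∃ f : ℕ → ℕ, Monotone f ∧ (∀ m : ℕ, ∃ n : ℕ, m ≤ f n) ∧
      ∀ (R : Type u) [NonUnitalRing R] (X : Set R), X.Finite → X.Nonempty →
        f X.ncard * X.ncard ≤ (X + X + X * X).ncard ∨
        ∃ R' I : Set R, IsSubringSet R' ∧ IsTwoSidedIdealIn I R' ∧
          I ⊆ R' ∩ (((X - X) + (X - X) + (X - X) + (X - X)) +
              (X - X) * ((X - X) + (X - X) + (X - X) + (X - X))) ∧
          I ⊆ R' ∩ iterX (X - X) 3 ∧
          (∃ m : ℕ, mulIter R' m ⊆ I) ∧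
          g X.ncard ≤ ((iterX (X - X) 3 ∩ R').ncard : ℝ) := by
  classical
  have hL5 : ∀ k : ℕ, ∃ L : ℕ, ∀ (R : Type u) [NonUnitalRing R] [DecidableEq R]
    (X : Finset R), X.Nonempty → (X + X + X * X).card ≤ k * X.card →
    ∃ R' I : Set R, IsSubringSet R' ∧ IsTwoSidedIdealIn I R' ∧ I ⊆ (↑(DD X) : Set R) ∧
      (∃ m : ℕ, mulIter R' m ⊆ I) ∧ X.card ≤ L * ((↑(DD X) : Set R) ∩ R').ncard := by
    intro k
    obtain ⟨L, hL⟩ := L5.{u} (k ^ 28)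
    exact ⟨L, fun R _ _ X hX h => hL R X hX (L1 X hX k h)⟩
  choose L hL using hL5
  refine ⟨fun n => Nat.findGreatest (fun k => (L k + 1 : ℝ) ≤ n / g n) n, ?_, ?_, ?_⟩
  · intro a b hab
    apply Nat.findGreatest_mono
    · intro k hk
      exact le_trans hk (hg_mono hab)
    · exact hab
  · intro m
    obtain ⟨n₀, hn₀⟩ := Filter.eventually_atTop.1 (hg_tendsto.eventually_ge_atTop (L m + 1 : ℝ))
    exact ⟨max n₀ m, Nat.le_findGreatest (le_max_right _ _) (hn₀ _ (le_max_left _ _))⟩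
  · intro R _ X hXf hXne
    set n := X.ncard with hn
    set k := Nat.findGreatest (fun k => (L k + 1 : ℝ) ≤ n / g n) n with hk
    by_cases hcase : k * n ≤ (X + X + X * X).ncard
    · exact Or.inl hcase
    right
    obtain ⟨X', rfl⟩ : ∃ X' : Finset R, X = ↑X' := ⟨hXf.toFinset, by simp⟩
    have hX' : X'.Nonempty := Finset.coe_nonempty.1 hXne
    rw [Set.ncard_coe_finset] at hn
    have hk0 : k ≠ 0 := by
      intro h
      rw [h] at hcase
      simp at hcase
    have hkL : (L k + 1 : ℝ) ≤ n / g n := Nat.findGreatest_of_ne_zero hk.symm hk0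
    have hcoe : ((X' : Set R) + X' + X' * X') = (↑(X' + X' + X' * X') : Set R) := by push_cast; rfl
    have hcard : (X' + X' + X' * X').card ≤ k * X'.card := by
      rw [hcoe, Set.ncard_coe_finset, hn] at hcase
      omega
    obtain ⟨R', I, h1, h2, h3, h4, h5⟩ := hL k R X' hX' hcard
    have hDcoe : (↑(DD X') : Set R) = ((((X' : Set R) - X') + (X' - X') + (X' - X') + (X' - X')) +
              (X' - X') * ((X' - X') + (X' - X') + (X' - X') + (X' - X'))) := by
      unfold DD; push_cast; rfl
    have h0 : (0 : R) ∈ (X' : Set R) - (X' : Set R) := by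
      obtain ⟨x, hx⟩ := hXne
      exact ⟨x, hx, x, hx, sub_self x⟩
    have hDi := D_iter _ h0
    rw [← hDcoe] at hDi
    refine ⟨R', I, h1, h2, ?_, Set.subset_inter h2.1 (h3.trans hDi), h4, ?_⟩
    · rw [← hDcoe]; exact Set.subset_inter h2.1 h3
    · have hfin : (iterX ((X' : Set R) - (X' : Set R)) 3 ∩ R').Finite :=
        (iter_fin _ (Set.Finite.sub hXf hXf) 3).inter_of_left _
      have h6 : ((↑(DD X') : Set R) ∩ R').ncard ≤ (iterX ((X' : Set R) - (X' : Set R)) 3 ∩ R').ncard :=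
        Set.ncard_le_ncard (Set.inter_subset_inter_left _ hDi) hfin
      have h7 : n ≤ L k * (iterX ((X' : Set R) - (X' : Set R)) 3 ∩ R').ncard := by
        rw [hn]; exact h5.trans (Nat.mul_le_mul_left _ h6)
      have h7' : (n : ℝ) ≤ L k * ((iterX ((X' : Set R) - (X' : Set R)) 3 ∩ R').ncard : ℝ) := by
        exact_mod_cast h7
      rw [le_div_iff₀ (hg_pos n)] at hkL
      have hLk : (0 : ℝ) ≤ L k := Nat.cast_nonneg _
      have hm : (0 : ℝ) ≤ ((iterX ((X' : Set R) - (X' : Set R)) 3 ∩ R').ncard : ℝ) := Nat.cast_nonneg _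
      have h8 : (L k + 1 : ℝ) * g n ≤ (L k + 1) * ((iterX ((X' : Set R) - (X' : Set R)) 3 ∩ R').ncard : ℝ) := by
        linarith
      exact le_of_mul_le_mul_left h8 (by positivity)
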